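/- arXiv:1206.3624 — 3 statements merged into one kernel-verified Lean document; each statement's English description precedes it below -/
import Mathlib

section
/- Let (ρ,u,w,b,θ) be a smooth solution of the planar compressible MHD system on Q_T. Define P̃ = u_x − ρu² − ρθ − |b|²/2 and φ(x,t) = ∫₀ᵗ P̃(x,τ) dτ + ∫₀ˣ ρ₀(ξ) u₀(ξ) dξ. Then on Q_T one has φ_x = ρu and φ_t = P̃, and the function ρ e^φ satisfies the pointwise identity ∂_t(ρ e^φ) + u ∂_x(ρ e^φ) = −(ρθ + |b|²/2) ρ e^φ; in particular ∂_t(ρ e^φ) + u ∂_x(ρ e^φ) ≤ 0 on Q_T. -/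
open Real MeasureTheory Set

noncomputable section

/-- Partial derivative in the first (spatial) variable of `f : ℝ → ℝ → ℝ`, `f x t`. -/
def pdx (f : ℝ → ℝ → ℝ) : ℝ → ℝ → ℝ := fun x t => deriv (fun y => f y t) x

/-- Partial derivative in the second (time) variable. -/
def pdt (f : ℝ → ℝ → ℝ) : ℝ → ℝ → ℝ := fun x t => deriv (fun s => f x s) t

/-- The `L²(0,1)` norm of a function. -/
def L2norm (f : ℝ → ℝ) : ℝ := Real.sqrt (∫ x in (0:ℝ)..1, (f x) ^ 2)

/-- The `H²(0,1)` norm of a (smooth) function. -/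
def H2norm (f : ℝ → ℝ) : ℝ :=
  Real.sqrt (∫ x in (0:ℝ)..1, (f x) ^ 2 + (deriv f x) ^ 2 + (deriv (deriv f) x) ^ 2)

/-- A smooth solution of the planar compressible MHD system (all physical constants
normalized to `1`, perfect-gas pressure `P = ρθ`, heat conductivity `κ`) on
`Q_T = [0,1] × [0,T]`:  `ρ, u, θ` are scalar fields, `w, b` are `ℝ²`-valued fields
(given by their two components), everything is smooth, `ρ > 0` and `θ > 0` on `Q_T`,
the five PDEs hold on `Q_T`, and the boundary conditions
`u = 0`, `w = 0`, `b = 0`, `θ_x = 0` hold at `x = 0` and `x = 1`. -/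
structure MHDSol (T : ℝ) (κ : ℝ → ℝ) where
  ρ : ℝ → ℝ → ℝ
  u : ℝ → ℝ → ℝ
  θ : ℝ → ℝ → ℝ
  w : Fin 2 → ℝ → ℝ → ℝ
  b : Fin 2 → ℝ → ℝ → ℝ
  smooth_ρ : ContDiff ℝ (⊤ : ℕ∞) (Function.uncurry ρ)
  smooth_u : ContDiff ℝ (⊤ : ℕ∞) (Function.uncurry u)
  smooth_θ : ContDiff ℝ (⊤ : ℕ∞) (Function.uncurry θ)
  smooth_w : ∀ i, ContDiff ℝ (⊤ : ℕ∞) (Function.uncurry (w i))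
  smooth_b : ∀ i, ContDiff ℝ (⊤ : ℕ∞) (Function.uncurry (b i))
  ρ_pos : ∀ x ∈ Set.Icc (0:ℝ) 1, ∀ t ∈ Set.Icc (0:ℝ) T, 0 < ρ x t
  θ_pos : ∀ x ∈ Set.Icc (0:ℝ) 1, ∀ t ∈ Set.Icc (0:ℝ) T, 0 < θ x t
  eq_mass : ∀ x ∈ Set.Icc (0:ℝ) 1, ∀ t ∈ Set.Icc (0:ℝ) T,
    pdt ρ x t + pdx (fun x t => ρ x t * u x t) x t = 0
  eq_mom : ∀ x ∈ Set.Icc (0:ℝ) 1, ∀ t ∈ Set.Icc (0:ℝ) T,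
    pdt (fun x t => ρ x t * u x t) x t
      + pdx (fun x t =>
          ρ x t * (u x t) ^ 2 + ρ x t * θ x t + (∑ i, (b i x t) ^ 2) / 2) x t
      = pdx (pdx u) x t
  eq_w : ∀ i, ∀ x ∈ Set.Icc (0:ℝ) 1, ∀ t ∈ Set.Icc (0:ℝ) T,
    pdt (fun x t => ρ x t * w i x t) x t
      + pdx (fun x t => ρ x t * u x t * w i x t - b i x t) x t
      = pdx (pdx (w i)) x t
  eq_b : ∀ i, ∀ x ∈ Set.Icc (0:ℝ) 1, ∀ t ∈ Set.Icc (0:ℝ) T,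
    pdt (b i) x t + pdx (fun x t => u x t * b i x t - w i x t) x t
      = pdx (pdx (b i)) x t
  eq_θ : ∀ x ∈ Set.Icc (0:ℝ) 1, ∀ t ∈ Set.Icc (0:ℝ) T,
    pdt (fun x t => ρ x t * θ x t) x t
      + pdx (fun x t => ρ x t * u x t * θ x t) x t
      - pdx (fun x t => κ (θ x t) * pdx θ x t) x t
      = (pdx u x t) ^ 2 + (∑ i, (pdx (w i) x t) ^ 2) + (∑ i, (pdx (b i) x t) ^ 2)
        - ρ x t * θ x t * pdx u x t
  bc_u : ∀ t ∈ Set.Icc (0:ℝ) T, u 0 t = 0 ∧ u 1 t = 0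
  bc_w : ∀ i, ∀ t ∈ Set.Icc (0:ℝ) T, w i 0 t = 0 ∧ w i 1 t = 0
  bc_b : ∀ i, ∀ t ∈ Set.Icc (0:ℝ) T, b i 0 t = 0 ∧ b i 1 t = 0
  bc_θ : ∀ t ∈ Set.Icc (0:ℝ) T, pdx θ 0 t = 0 ∧ pdx θ 1 t = 0

/-- The heat conductivity `κ` is `C²` on `[0,∞)` and satisfies
`C₀⁻¹ (1 + s^q) ≤ κ(s) ≤ C₀ (1 + s^q)` there. -/
def KappaHyp (q C₀ : ℝ) (κ : ℝ → ℝ) : Prop :=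
  ContDiffOn ℝ 2 κ (Set.Ici 0) ∧
  (∀ s : ℝ, 0 ≤ s → C₀⁻¹ * (1 + s ^ q) ≤ κ s) ∧
  (∀ s : ℝ, 0 ≤ s → κ s ≤ C₀ * (1 + s ^ q))

/-- Bounds on the initial data: `A` is an upper bound for the `H²(0,1)` norms of
`ρ₀, u₀, w₀, b₀, θ₀`, `B` is an upper bound for `∫₀¹ ρ₀ (|ln ρ₀| + |ln θ₀|) dx`, and
`M` is a (positive) lower bound for the total mass `∫₀¹ ρ₀ dx`. -/
def InitBounds {T : ℝ} {κ : ℝ → ℝ} (sol : MHDSol T κ) (A B M : ℝ) : Prop :=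
  H2norm (fun x => sol.ρ x 0) ≤ A ∧ H2norm (fun x => sol.u x 0) ≤ A ∧
  H2norm (fun x => sol.θ x 0) ≤ A ∧
  (∀ i, H2norm (fun x => sol.w i x 0) ≤ A) ∧
  (∀ i, H2norm (fun x => sol.b i x 0) ≤ A) ∧
  (∫ x in (0:ℝ)..1, sol.ρ x 0 * (|Real.log (sol.ρ x 0)| + |Real.log (sol.θ x 0)|)) ≤ B ∧
  M ≤ ∫ x in (0:ℝ)..1, sol.ρ x 0

/-- `G` is an upper bound for the `L²(0,1)` norms of the compatibility functions
`g₁ = (∂ₓ²u₀ − ∂ₓ(ρ₀θ₀ + |b₀|²/2))/√ρ₀`, `g₂ = (∂ₓ²w₀ − ∂ₓb₀)/√ρ₀`,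
`g₃ = (∂ₓ(κ(θ₀)∂ₓθ₀) + (∂ₓu₀)² + |∂ₓw₀|² + |∂ₓb₀|²)/√ρ₀`. -/
def CompatBounds {T : ℝ} {κ : ℝ → ℝ} (sol : MHDSol T κ) (G : ℝ) : Prop :=
  L2norm (fun x =>
      (pdx (pdx sol.u) x 0
        - pdx (fun x t => sol.ρ x t * sol.θ x t + (∑ i, (sol.b i x t) ^ 2) / 2) x 0)
      / Real.sqrt (sol.ρ x 0)) ≤ G ∧
  (∀ i, L2norm (fun x =>
      (pdx (pdx (sol.w i)) x 0 - pdx (sol.b i) x 0) / Real.sqrt (sol.ρ x 0)) ≤ G) ∧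
  L2norm (fun x =>
      (pdx (fun x t => κ (sol.θ x t) * pdx sol.θ x t) x 0
        + (pdx sol.u x 0) ^ 2 + (∑ i, (pdx (sol.w i) x 0) ^ 2)
        + (∑ i, (pdx (sol.b i) x 0) ^ 2))
      / Real.sqrt (sol.ρ x 0)) ≤ G

/-- Slices in the first variable of a smooth function have the derivative `pdx`. -/
lemma hasDerivAt_pdx {f : ℝ → ℝ → ℝ} (hf : ContDiff ℝ (⊤ : ℕ∞) (Function.uncurry f)) (x t : ℝ) :
    HasDerivAt (fun y => f y t) (pdx f x t) x := by
  have h1 : ContDiff ℝ (⊤ : ℕ∞) (fun y : ℝ => Function.uncurry f (y, t)) :=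
    hf.comp (contDiff_id.prodMk contDiff_const)
  exact (h1.differentiable (by simp) x).hasDerivAt

lemma hasDerivAt_pdt {f : ℝ → ℝ → ℝ} (hf : ContDiff ℝ (⊤ : ℕ∞) (Function.uncurry f)) (x t : ℝ) :
    HasDerivAt (fun s => f x s) (pdt f x t) t := by
  have h1 : ContDiff ℝ (⊤ : ℕ∞) (fun s : ℝ => Function.uncurry f (x, s)) :=
    hf.comp (contDiff_const.prodMk contDiff_id)
  exact (h1.differentiable (by simp) t).hasDerivAt

lemma contDiff_pdx {f : ℝ → ℝ → ℝ} (hf : ContDiff ℝ (⊤ : ℕ∞) (Function.uncurry f)) :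
    ContDiff ℝ (⊤ : ℕ∞) (Function.uncurry (pdx f)) := by
  have h2 : Function.uncurry (pdx f)
      = fun p : ℝ × ℝ => fderiv ℝ (Function.uncurry f) p (1, 0) := by
    funext p
    obtain ⟨x, t⟩ := p
    have hd := (hf.differentiable (by simp) (x, t)).hasFDerivAt
    have hc : HasDerivAt (fun y : ℝ => (y, t)) ((1 : ℝ), (0 : ℝ)) x :=
      (hasDerivAt_id x).prodMk (hasDerivAt_const x t)
    have := hd.comp_hasDerivAt x hc
    exact (hasDerivAt_pdx hf x t).unique this
  rw [h2]
  exact (hf.fderiv_right (m := ((⊤ : ℕ∞) : WithTop ℕ∞)) (by simp)).clm_apply contDiff_const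

lemma contDiff_pdt {f : ℝ → ℝ → ℝ} (hf : ContDiff ℝ (⊤ : ℕ∞) (Function.uncurry f)) :
    ContDiff ℝ (⊤ : ℕ∞) (Function.uncurry (pdt f)) := by
  have h2 : Function.uncurry (pdt f)
      = fun p : ℝ × ℝ => fderiv ℝ (Function.uncurry f) p (0, 1) := by
    funext p
    obtain ⟨x, t⟩ := p
    have hd := (hf.differentiable (by simp) (x, t)).hasFDerivAt
    have hc : HasDerivAt (fun y : ℝ => (x, y)) ((0 : ℝ), (1 : ℝ)) t :=
      (hasDerivAt_const t x).prodMk (hasDerivAt_id t)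
    have := hd.comp_hasDerivAt t hc
    exact (hasDerivAt_pdt hf x t).unique this
  rw [h2]
  exact (hf.fderiv_right (m := ((⊤ : ℕ∞) : WithTop ℕ∞)) (by simp)).clm_apply contDiff_const

lemma continuous_slice {f : ℝ → ℝ → ℝ} (hf : ContDiff ℝ (⊤ : ℕ∞) (Function.uncurry f)) (x : ℝ) :
    Continuous (fun t => f x t) :=
  hf.continuous.comp (continuous_const.prodMk continuous_id)

/-- Differentiation under the integral sign. -/
lemma hasDerivAt_integral_pdx {f : ℝ → ℝ → ℝ} (hf : ContDiff ℝ (⊤ : ℕ∞) (Function.uncurry f))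
    (x a b : ℝ) :
    HasDerivAt (fun y => ∫ τ in a..b, f y τ) (∫ τ in a..b, pdx f x τ) x := by
  have hg := contDiff_pdx hf
  obtain ⟨C, hC⟩ := ((isCompact_closedBall x 1).prod (isCompact_uIcc (a := a) (b := b))).exists_bound_of_continuousOn
    hg.continuous.continuousOn
  refine (intervalIntegral.hasDerivAt_integral_of_dominated_loc_of_deriv_le
    (F := f) (F' := pdx f) (bound := fun _ => C)
    (Metric.closedBall_mem_nhds x one_pos) ?_ ?_ ?_ ?_ ?_ ?_).2
  · exact Filter.Eventually.of_forall fun y => (continuous_slice hf y).aestronglyMeasurable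
  · exact (continuous_slice hf x).intervalIntegrable _ _
  · exact (continuous_slice hg x).aestronglyMeasurable
  · exact Filter.Eventually.of_forall fun τ hτ y hy => hC (y, τ) ⟨hy, uIoc_subset_uIcc hτ⟩
  · exact intervalIntegrable_const
  · exact Filter.Eventually.of_forall fun τ _ y _ => hasDerivAt_pdx hf y τ

/-- with `P̃ = u_x − ρu² − ρθ − |b|²/2` and
`φ(x,t) = ∫₀ᵗ P̃(x,τ) dτ + ∫₀ˣ ρ₀ u₀ dξ`, one has `φ_x = ρu`, `φ_t = P̃` on `Q_T`, and
`∂_t(ρ e^φ) + u ∂_x(ρ e^φ) = −(ρθ + |b|²/2) ρ e^φ ≤ 0` on `Q_T`. -/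
theorem stmt7 (T q C₀ : ℝ) (hT : 0 < T) (hq : 0 < q) (hC₀ : 1 ≤ C₀)
    (κ : ℝ → ℝ) (hκ : KappaHyp q C₀ κ)
    (sol : MHDSol T κ) (Pt φ : ℝ → ℝ → ℝ)
    (hPt : ∀ x t, Pt x t
      = pdx sol.u x t - sol.ρ x t * (sol.u x t) ^ 2 - sol.ρ x t * sol.θ x t
        - (∑ i, (sol.b i x t) ^ 2) / 2)
    (hφ : ∀ x t, φ x t
      = (∫ τ in (0:ℝ)..t, Pt x τ) + ∫ ξ in (0:ℝ)..x, sol.ρ ξ 0 * sol.u ξ 0) :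
    ∀ x ∈ Set.Icc (0:ℝ) 1, ∀ t ∈ Set.Icc (0:ℝ) T,
      pdx φ x t = sol.ρ x t * sol.u x t ∧
      pdt φ x t = Pt x t ∧
      pdt (fun x t => sol.ρ x t * Real.exp (φ x t)) x t
        + sol.u x t * pdx (fun x t => sol.ρ x t * Real.exp (φ x t)) x t
        = -(sol.ρ x t * sol.θ x t + (∑ i, (sol.b i x t) ^ 2) / 2)
            * (sol.ρ x t * Real.exp (φ x t)) ∧
      pdt (fun x t => sol.ρ x t * Real.exp (φ x t)) x t
        + sol.u x t * pdx (fun x t => sol.ρ x t * Real.exp (φ x t)) x t ≤ 0 := by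
  have hρ := sol.smooth_ρ
  have hu := sol.smooth_u
  have hθ := sol.smooth_θ
  have hb := sol.smooth_b
  have hux := contDiff_pdx hu
  have hρu : ContDiff ℝ (⊤ : ℕ∞) (Function.uncurry fun x t => sol.ρ x t * sol.u x t) :=
    hρ.mul hu
  have hF : ContDiff ℝ (⊤ : ℕ∞) (Function.uncurry fun x t =>
      sol.ρ x t * (sol.u x t) ^ 2 + sol.ρ x t * sol.θ x t + (∑ i, (sol.b i x t) ^ 2) / 2) :=
    ((hρ.mul (hu.pow 2)).add (hρ.mul hθ)).add
      ((ContDiff.sum fun i _ => (hb i).pow 2).div_const 2)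
  have hPeq : Pt = fun x t => pdx sol.u x t - (sol.ρ x t * (sol.u x t) ^ 2
      + sol.ρ x t * sol.θ x t + (∑ i, (sol.b i x t) ^ 2) / 2) := by
    funext x t
    rw [hPt]
    ring
  have hP : ContDiff ℝ (⊤ : ℕ∞) (Function.uncurry Pt) := by
    rw [hPeq]
    exact hux.sub hF
  intro x hx t ht
  have hφx : HasDerivAt (fun y => φ y t) (sol.ρ x t * sol.u x t) x := by
    have e : (fun y => φ y t) = fun y => (∫ τ in (0:ℝ)..t, Pt y τ)
        + ∫ ξ in (0:ℝ)..y, sol.ρ ξ 0 * sol.u ξ 0 := by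
      funext y
      exact hφ y t
    have hc : Continuous fun ξ => sol.ρ ξ 0 * sol.u ξ 0 :=
      hρu.continuous.comp (continuous_id.prodMk continuous_const)
    have h1 := (hasDerivAt_integral_pdx hP x 0 t).add
      (hc.integral_hasStrictDerivAt 0 x).hasDerivAt
    have h2 : (∫ τ in (0:ℝ)..t, pdx Pt x τ)
        = sol.ρ x t * sol.u x t - sol.ρ x 0 * sol.u x 0 := by
      refine intervalIntegral.integral_eq_sub_of_hasDerivAt
        (f := fun τ => sol.ρ x τ * sol.u x τ) ?_
        ((continuous_slice (contDiff_pdx hP) x).intervalIntegrable _ _)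
      intro τ hτ
      rw [uIcc_of_le ht.1] at hτ
      have hm := sol.eq_mom x hx τ ⟨hτ.1, hτ.2.trans ht.2⟩
      have h3 := (hasDerivAt_pdx hux x τ).sub (hasDerivAt_pdx hF x τ)
      have e4 : (fun y => Pt y τ) = fun y => pdx sol.u y τ - (sol.ρ y τ * (sol.u y τ) ^ 2
          + sol.ρ y τ * sol.θ y τ + (∑ i, (sol.b i y τ) ^ 2) / 2) := by
        rw [hPeq]
      have h4 := hasDerivAt_pdx hP x τ
      rw [e4] at h4
      have h5 := h4.unique h3
      rw [h5, ← hm, add_sub_cancel_right]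
      exact hasDerivAt_pdt hρu x τ
    rw [h2, sub_add_cancel] at h1
    rw [e]
    exact h1
  have hφt : HasDerivAt (fun s => φ x s) (Pt x t) t := by
    have e : (fun s => φ x s) = fun s => (∫ τ in (0:ℝ)..s, Pt x τ)
        + ∫ ξ in (0:ℝ)..x, sol.ρ ξ 0 * sol.u ξ 0 := by
      funext s
      exact hφ x s
    rw [e]
    exact ((continuous_slice hP x).integral_hasStrictDerivAt 0 t).hasDerivAt.add_const _
  have hid : pdt (fun x t => sol.ρ x t * Real.exp (φ x t)) x t
        + sol.u x t * pdx (fun x t => sol.ρ x t * Real.exp (φ x t)) x t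
        = -(sol.ρ x t * sol.θ x t + (∑ i, (sol.b i x t) ^ 2) / 2)
            * (sol.ρ x t * Real.exp (φ x t)) := by
    have ht' : pdt (fun x t => sol.ρ x t * Real.exp (φ x t)) x t = _ :=
      ((hasDerivAt_pdt hρ x t).mul hφt.exp).deriv
    have hx' : pdx (fun x t => sol.ρ x t * Real.exp (φ x t)) x t = _ :=
      ((hasDerivAt_pdx hρ x t).mul hφx.exp).deriv
    have hm' : pdx (fun x t => sol.ρ x t * sol.u x t) x t = _ :=
      ((hasDerivAt_pdx hρ x t).mul (hasDerivAt_pdx hu x t)).deriv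
    have hm := sol.eq_mass x hx t ht
    rw [hm'] at hm
    have hm2 : pdt sol.ρ x t
        = -(pdx sol.ρ x t * sol.u x t + sol.ρ x t * pdx sol.u x t) := by linarith
    rw [ht', hx', hPt, hm2]
    ring
  refine ⟨hφx.deriv, hφt.deriv, hid, ?_⟩
  rw [hid]
  have h1 := sol.ρ_pos x hx t ht
  have h2 := sol.θ_pos x hx t ht
  have h3 : 0 ≤ ∑ i, (sol.b i x t) ^ 2 := Finset.sum_nonneg fun i _ => sq_nonneg _
  have h4 : 0 ≤ (sol.ρ x t * sol.θ x t + (∑ i, (sol.b i x t) ^ 2) / 2)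
      * (sol.ρ x t * Real.exp (φ x t)) := by positivity
  linarith
end
end

section
/- There exists a constant C depending only on T, q, C₀ and on the initial data ρ₀,u₀,w₀,b₀,θ₀ — specifically on upper bounds for their H²((0,1))-norms, an upper bound for ∫₀¹ ρ₀(|ln ρ₀| + |ln θ₀|) dx, and a positive lower bound for ∫₀¹ ρ₀ dx — but not on the pointwise lower bounds of ρ₀ and θ₀, such that every smooth solution (ρ,u,w,b,θ) of the planar compressible MHD system on Q_T satisfies 0 ≤ ρ(x,t) ≤ C for all (x,t) ∈ Q_T. -/
open Real MeasureTheory Set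

noncomputable section

namespace MHDaux

/-- smoothness of a function of two variables -/
abbrev Sm (f : ℝ → ℝ → ℝ) : Prop := ContDiff ℝ (⊤ : ℕ∞) (Function.uncurry f)

lemma Sm.hx {f : ℝ → ℝ → ℝ} (h : Sm f) (x t : ℝ) :
    HasDerivAt (fun y => f y t) (pdx f x t) x := by
  have h1 : ContDiff ℝ (⊤ : ℕ∞) (fun y => f y t) :=
    h.comp (contDiff_id.prodMk contDiff_const)
  exact ((h1.differentiable (by simp)) x).hasDerivAt

lemma Sm.ht {f : ℝ → ℝ → ℝ} (h : Sm f) (x t : ℝ) :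
    HasDerivAt (fun s => f x s) (pdt f x t) t := by
  have h1 : ContDiff ℝ (⊤ : ℕ∞) (fun s => f x s) :=
    h.comp (contDiff_const.prodMk contDiff_id)
  exact ((h1.differentiable (by simp)) t).hasDerivAt

lemma Sm.pdx {f : ℝ → ℝ → ℝ} (h : Sm f) : Sm (pdx f) := by
  have h2 : Function.uncurry (_root_.pdx f)
      = fun p => fderiv ℝ (Function.uncurry f) p (1, 0) := by
    funext p
    obtain ⟨x, t⟩ := p
    have hd := ((h.differentiable (by simp)) (x, t)).hasFDerivAt
    have hc : HasDerivAt (fun y : ℝ => (y, t)) ((1 : ℝ), (0 : ℝ)) x :=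
      (hasDerivAt_id x).prodMk (hasDerivAt_const x t)
    exact (hd.comp_hasDerivAt x hc).deriv
  unfold Sm
  rw [h2]
  exact (h.fderiv_right (m := (⊤ : ℕ∞)) (by simp)).clm_apply contDiff_const

lemma Sm.pdt {f : ℝ → ℝ → ℝ} (h : Sm f) : Sm (pdt f) := by
  have h2 : Function.uncurry (_root_.pdt f)
      = fun p => fderiv ℝ (Function.uncurry f) p (0, 1) := by
    funext p
    obtain ⟨x, t⟩ := p
    have hd := ((h.differentiable (by simp)) (x, t)).hasFDerivAt
    have hc : HasDerivAt (fun y : ℝ => (x, y)) ((0 : ℝ), (1 : ℝ)) t :=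
      (hasDerivAt_const t x).prodMk (hasDerivAt_id t)
    exact (hd.comp_hasDerivAt t hc).deriv
  unfold Sm
  rw [h2]
  exact (h.fderiv_right (m := (⊤ : ℕ∞)) (by simp)).clm_apply contDiff_const

lemma Sm.cx {f : ℝ → ℝ → ℝ} (h : Sm f) (t : ℝ) : Continuous (fun y => f y t) :=
  h.continuous.comp (by fun_prop : Continuous fun y : ℝ => (y, t))

lemma Sm.ct {f : ℝ → ℝ → ℝ} (h : Sm f) (x : ℝ) : Continuous (fun s => f x s) :=
  h.continuous.comp (by fun_prop : Continuous fun y : ℝ => (x, y))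

lemma Sm.int {f : ℝ → ℝ → ℝ} (h : Sm f) (t a b : ℝ) :
    IntervalIntegrable (fun y => f y t) volume a b := (h.cx t).intervalIntegrable a b

lemma Sm.mul {f g : ℝ → ℝ → ℝ} (hf : Sm f) (hg : Sm g) : Sm (fun x t => f x t * g x t) :=
  ContDiff.mul hf hg

lemma Sm.add {f g : ℝ → ℝ → ℝ} (hf : Sm f) (hg : Sm g) : Sm (fun x t => f x t + g x t) :=
  ContDiff.add hf hg

lemma Sm.sub {f g : ℝ → ℝ → ℝ} (hf : Sm f) (hg : Sm g) : Sm (fun x t => f x t - g x t) :=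
  ContDiff.sub hf hg

lemma Sm.const (c : ℝ) : Sm (fun _ _ => c) := contDiff_const

lemma Sm.integral_cont {f : ℝ → ℝ → ℝ} (h : Sm f) (a b : ℝ) :
    Continuous (fun t => ∫ y in a..b, f y t) := by
  apply intervalIntegral.continuous_parametric_intervalIntegral_of_continuous'
  exact h.continuous.comp (by fun_prop : Continuous fun p : ℝ × ℝ => (p.2, p.1))

lemma Sm.integral_deriv {f : ℝ → ℝ → ℝ} (h : Sm f) (a b t : ℝ) :
    HasDerivAt (fun t => ∫ y in a..b, f y t) (∫ y in a..b, _root_.pdt f y t) t := by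
  have hc : ContinuousOn (Function.uncurry (_root_.pdt f))
      (Set.uIcc a b ×ˢ Set.Icc (t-1) (t+1)) := h.pdt.continuous.continuousOn
  obtain ⟨K, hK⟩ := (isCompact_uIcc.prod isCompact_Icc).exists_bound_of_continuousOn hc
  refine (intervalIntegral.hasDerivAt_integral_of_dominated_loc_of_deriv_le
    (F := fun t y => f y t) (F' := fun t y => _root_.pdt f y t) (bound := fun _ => K)
    (s := Set.Icc (t-1) (t+1)) (Icc_mem_nhds (by linarith) (by linarith)) ?_ ?_ ?_ ?_ ?_ ?_).2
  · exact Filter.Eventually.of_forall fun s => (h.cx s).aestronglyMeasurable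
  · exact h.int t a b
  · exact (h.pdt.cx t).aestronglyMeasurable
  · refine Filter.Eventually.of_forall fun y hy s hs => ?_
    exact hK (y, s) ⟨Set.uIoc_subset_uIcc hy, hs⟩
  · exact intervalIntegrable_const
  · exact Filter.Eventually.of_forall fun y _ s _ => h.ht y s

/-- sup bound from the `H²` norm -/
lemma sup_bound {f : ℝ → ℝ} (hf : ContDiff ℝ (⊤ : ℕ∞) f) {A : ℝ} (hA : H2norm f ≤ A)
    {x : ℝ} (hx : x ∈ Set.Icc (0:ℝ) 1) : |f x| ≤ 1 + A ^ 2 := by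
  have hd : ContDiff ℝ (⊤ : ℕ∞) (deriv f) := hf.deriv'
  have hdd : ContDiff ℝ (⊤ : ℕ∞) (deriv (deriv f)) := hd.deriv'
  have c0 := hf.continuous
  have c1 := hd.continuous
  have c2 := hdd.continuous
  have hI : (∫ x in (0:ℝ)..1, (f x) ^ 2 + (deriv f x) ^ 2 + (deriv (deriv f) x) ^ 2) ≤ A ^ 2 := by
    unfold H2norm at hA
    exact (Real.sqrt_le_left (le_trans (Real.sqrt_nonneg _) hA)).1 hA
  have key : ∀ y ∈ Set.Icc (0:ℝ) 1, |f x| ≤ |f y| + ∫ z in (0:ℝ)..1, |deriv f z| := by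
    intro y hy
    have h1 : ∫ z in y..x, deriv f z = f x - f y :=
      intervalIntegral.integral_deriv_eq_sub (fun z _ => (hf.differentiable (by simp)) z)
        (c1.intervalIntegrable _ _)
    have h2 : |∫ z in y..x, deriv f z| ≤ ∫ z in (0:ℝ)..1, |deriv f z| := by
      have := intervalIntegral.norm_integral_le_integral_norm_uIoc (f := deriv f) (a := y) (b := x)
        (μ := volume)
      refine le_trans this ?_
      rw [intervalIntegral.integral_of_le zero_le_one]
      apply setIntegral_mono_set
      · exact ((c1.abs.intervalIntegrable 0 1).1)
      · exact Filter.Eventually.of_forall fun _ => norm_nonneg _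
      · apply HasSubset.Subset.eventuallyLE
        intro z hz
        rw [Set.mem_uIoc] at hz
        obtain ⟨a, b⟩ := hx
        obtain ⟨c, d⟩ := hy
        rcases hz with hz | hz
        · exact ⟨by linarith [hz.1], by linarith [hz.2]⟩
        · exact ⟨by linarith [hz.1], by linarith [hz.2]⟩
    rw [h1] at h2
    have := abs_sub_abs_le_abs_sub (f x) (f y)
    linarith
  have h3 : ∫ y in (0:ℝ)..1, |f x| ≤ ∫ y in (0:ℝ)..1, (|f y| + ∫ z in (0:ℝ)..1, |deriv f z|) :=
    intervalIntegral.integral_mono_on zero_le_one (by simp)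
      ((by fun_prop : Continuous fun y => |f y| + ∫ z in (0:ℝ)..1, |deriv f z|).intervalIntegrable
        _ _) key
  rw [intervalIntegral.integral_add (c0.abs.intervalIntegrable _ _) (by simp)] at h3
  simp only [intervalIntegral.integral_const, sub_zero, smul_eq_mul, one_mul] at h3
  rw [← intervalIntegral.integral_add (c0.abs.intervalIntegrable _ _)
    (c1.abs.intervalIntegrable _ _)] at h3
  have h4 : ∫ y in (0:ℝ)..1, (|f y| + |deriv f y|) ≤
      ∫ y in (0:ℝ)..1, (1 + ((f y) ^ 2 + (deriv f y) ^ 2 + (deriv (deriv f) y) ^ 2)) := by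
    apply intervalIntegral.integral_mono_on zero_le_one
    · exact (by fun_prop : Continuous fun y => |f y| + |deriv f y|).intervalIntegrable _ _
    · exact (by fun_prop : Continuous fun y =>
        (1 + ((f y) ^ 2 + (deriv f y) ^ 2 + (deriv (deriv f) y) ^ 2))).intervalIntegrable _ _
    · intro y _
      nlinarith [sq_nonneg (|f y| - 1), sq_nonneg (|deriv f y| - 1), sq_abs (f y),
        sq_abs (deriv f y), sq_nonneg (deriv (deriv f) y), sq_nonneg (f y), sq_nonneg (deriv f y)]
  rw [intervalIntegral.integral_add (by simp) ((by fun_prop : Continuous fun y =>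
        ((f y) ^ 2 + (deriv f y) ^ 2 + (deriv (deriv f) y) ^ 2)).intervalIntegrable _ _)] at h4
  simp only [intervalIntegral.integral_const, sub_zero, smul_eq_mul, one_mul] at h4
  linarith

/-- maximum principle for transport inequalities -/
lemma max_principle {T : ℝ} (hT : 0 < T) {g gx gt u : ℝ → ℝ → ℝ} {N : ℝ}
    (hc : ContinuousOn (Function.uncurry g) (Set.Icc (0:ℝ) 1 ×ˢ Set.Icc (0:ℝ) T))
    (hgx : ∀ x ∈ Set.Icc (0:ℝ) 1, ∀ t ∈ Set.Icc (0:ℝ) T, HasDerivAt (fun y => g y t) (gx x t) x)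
    (hgt : ∀ x ∈ Set.Icc (0:ℝ) 1, ∀ t ∈ Set.Icc (0:ℝ) T, HasDerivAt (fun s => g x s) (gt x t) t)
    (hu : ∀ t ∈ Set.Icc (0:ℝ) T, u 0 t = 0 ∧ u 1 t = 0)
    (hle : ∀ x ∈ Set.Icc (0:ℝ) 1, ∀ t ∈ Set.Icc (0:ℝ) T, gt x t + u x t * gx x t ≤ 0)
    (h0 : ∀ x ∈ Set.Icc (0:ℝ) 1, g x 0 ≤ N) :
    ∀ x ∈ Set.Icc (0:ℝ) 1, ∀ t ∈ Set.Icc (0:ℝ) T, g x t ≤ N := by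
  have step : ∀ ε > 0, ∀ x ∈ Set.Icc (0:ℝ) 1, ∀ t ∈ Set.Icc (0:ℝ) T, g x t - ε * t ≤ N := by
    intro ε hε x hx t ht
    have hc2 : ContinuousOn (fun p : ℝ × ℝ => Function.uncurry g p - ε * p.2)
        (Set.Icc (0:ℝ) 1 ×ˢ Set.Icc (0:ℝ) T) :=
      hc.sub (by fun_prop)
    obtain ⟨⟨x0, t0⟩, ⟨hx0, ht0⟩, hmax⟩ := (isCompact_Icc.prod isCompact_Icc).exists_isMaxOn
      ⟨(x, t), hx, ht⟩ hc2
    simp only at hx0 ht0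
    have hm : ∀ y ∈ Set.Icc (0:ℝ) 1, ∀ s ∈ Set.Icc (0:ℝ) T,
        g y s - ε * s ≤ g x0 t0 - ε * t0 := fun y hy s hs =>
      hmax (show (y, s) ∈ Set.Icc (0:ℝ) 1 ×ˢ Set.Icc (0:ℝ) T from ⟨hy, hs⟩)
    refine le_trans (hm x hx t ht) ?_
    rcases eq_or_lt_of_le ht0.1 with h | h
    · rw [← h]; simpa using h0 x0 hx0
    exfalso
    have hux : u x0 t0 * gx x0 t0 = 0 := by
      rcases eq_or_lt_of_le hx0.1 with h1 | h1
      · rw [← h1, (hu t0 ht0).1, zero_mul]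
      rcases eq_or_lt_of_le hx0.2 with h2 | h2
      · rw [h2, (hu t0 ht0).2, zero_mul]
      have hl : IsLocalMax (fun y => g y t0) x0 := by
        filter_upwards [Icc_mem_nhds h1 h2] with y hy
        have := hm y hy t0 ht0
        linarith
      rw [hl.hasDerivAt_eq_zero (hgx x0 hx0 t0 ht0), mul_zero]
    have hneg : gt x0 t0 - ε < 0 := by
      have := hle x0 hx0 t0 ht0
      linarith
    have hd : HasDerivAt (fun s => g x0 s - ε * s) (gt x0 t0 - ε) t0 := by
      have h7 : HasDerivAt (fun s => ε * s) ε t0 := by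
        simpa using (hasDerivAt_id t0).const_mul ε
      exact (hgt x0 hx0 t0 ht0).sub h7
    have hs := (hasDerivAt_iff_tendsto_slope.1 hd).eventually (gt_mem_nhds hneg)
    have hs2 : ∀ᶠ s in nhdsWithin t0 (Set.Iio t0), slope (fun s => g x0 s - ε * s) t0 s < 0 :=
      hs.filter_mono (nhdsWithin_mono _ (fun s hs => ne_of_lt hs))
    have hs3 : ∀ᶠ s in nhdsWithin t0 (Set.Iio t0), s ∈ Set.Ioo 0 t0 :=
      Ioo_mem_nhdsLT h
    obtain ⟨s, hs4, hs5⟩ := (hs2.and hs3).exists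
    rw [slope_def_field] at hs4
    have := hm x0 hx0 s ⟨hs5.1.le, by linarith [hs5.2, ht0.2]⟩
    have h9 : 0 ≤ (g x0 s - ε * s - (g x0 t0 - ε * t0)) / (s - t0) :=
      div_nonneg_of_nonpos (by linarith) (by linarith [hs5.2])
    linarith
  intro x hx t ht
  by_contra hcon
  push Not at hcon
  have := step ((g x t - N) / (2 * T)) (by apply div_pos <;> linarith) x hx t ht
  have h5 : (g x t - N) / (2 * T) * t ≤ (g x t - N) / (2 * T) * T :=
    mul_le_mul_of_nonneg_left ht.2 (by apply div_nonneg <;> linarith)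
  have h6 : (g x t - N) / (2 * T) * T = (g x t - N) / 2 := by field_simp
  linarith

section
variable {T : ℝ} {κ : ℝ → ℝ} (sol : MHDSol T κ)

lemma massE {x t : ℝ} (hx : x ∈ Set.Icc (0:ℝ) 1) (ht : t ∈ Set.Icc (0:ℝ) T) :
    pdt sol.ρ x t + (pdx sol.ρ x t * sol.u x t + sol.ρ x t * pdx sol.u x t) = 0 := by
  have h := sol.eq_mass x hx t ht
  have h1 : pdx (fun x t => sol.ρ x t * sol.u x t) x t = _ :=
    ((Sm.hx sol.smooth_ρ x t).mul (Sm.hx sol.smooth_u x t)).deriv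
  rwa [h1] at h

/-- momentum flux -/
def Psi (x t : ℝ) : ℝ :=
  pdx sol.u x t - (sol.ρ x t * (sol.u x t) ^ 2 + sol.ρ x t * sol.θ x t
    + (∑ i, (sol.b i x t) ^ 2) / 2)

lemma smFlux : Sm (fun x t => sol.ρ x t * (sol.u x t) ^ 2 + sol.ρ x t * sol.θ x t
    + (∑ i, (sol.b i x t) ^ 2) / 2) := by
  have h1 := sol.smooth_ρ
  have h2 := sol.smooth_u
  have h3 := sol.smooth_θ
  have h4 := sol.smooth_b 0
  have h5 := sol.smooth_b 1
  simp only [Fin.sum_univ_two]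
  exact ContDiff.add (ContDiff.add (ContDiff.mul h1 (ContDiff.pow h2 2)) (ContDiff.mul h1 h3))
    (ContDiff.div_const (ContDiff.add (ContDiff.pow h4 2) (ContDiff.pow h5 2)) 2)

lemma smPsi : Sm (Psi sol) := ContDiff.sub (Sm.pdx sol.smooth_u) (smFlux sol)

lemma smRU : Sm (fun x t => sol.ρ x t * sol.u x t) := Sm.mul sol.smooth_ρ sol.smooth_u

lemma Psi_x {x t : ℝ} (hx : x ∈ Set.Icc (0:ℝ) 1) (ht : t ∈ Set.Icc (0:ℝ) T) :
    HasDerivAt (fun y => Psi sol y t) (pdt (fun x t => sol.ρ x t * sol.u x t) x t) x := by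
  have h := sol.eq_mom x hx t ht
  have h1 := (Sm.hx (Sm.pdx sol.smooth_u) x t).sub (Sm.hx (smFlux sol) x t)
  rw [show pdt (fun x t => sol.ρ x t * sol.u x t) x t = pdx (pdx sol.u) x t -
    pdx (fun x t => sol.ρ x t * (sol.u x t) ^ 2 + sol.ρ x t * sol.θ x t
    + (∑ i, (sol.b i x t) ^ 2) / 2) x t by linarith]
  exact h1

/-- energy density -/
def en (x t : ℝ) : ℝ :=
  sol.ρ x t * sol.θ x t + sol.ρ x t * (sol.u x t * sol.u x t + (sol.w 0 x t * sol.w 0 x t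
    + sol.w 1 x t * sol.w 1 x t)) * 2⁻¹ + (sol.b 0 x t * sol.b 0 x t
    + sol.b 1 x t * sol.b 1 x t) * 2⁻¹

lemma smEn : Sm (en sol) := by
  have h1 := sol.smooth_ρ
  have h2 := sol.smooth_u
  have h3 := sol.smooth_θ
  have h4 := sol.smooth_b 0
  have h5 := sol.smooth_b 1
  have h6 := sol.smooth_w 0
  have h7 := sol.smooth_w 1
  exact (((Sm.mul h1 h3).add (((Sm.mul h1 ((Sm.mul h2 h2).add
    ((Sm.mul h6 h6).add (Sm.mul h7 h7)))).mul (Sm.const 2⁻¹)))).add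
    (((Sm.mul h4 h4).add (Sm.mul h5 h5)).mul (Sm.const 2⁻¹)))

/-- energy flux -/
def fl (x t : ℝ) : ℝ :=
  sol.u x t * pdx sol.u x t
  + (sol.w 0 x t * pdx (sol.w 0) x t + sol.w 1 x t * pdx (sol.w 1) x t)
  + (sol.b 0 x t * pdx (sol.b 0) x t + sol.b 1 x t * pdx (sol.b 1) x t)
  + (sol.b 0 x t * sol.w 0 x t + sol.b 1 x t * sol.w 1 x t)
  - sol.u x t * (en sol x t + (sol.ρ x t * sol.θ x t + (sol.b 0 x t * sol.b 0 x t
    + sol.b 1 x t * sol.b 1 x t) * 2⁻¹))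
  + κ (sol.θ x t) * pdx sol.θ x t

set_option maxHeartbeats 1000000 in
lemma fl_x (hκ : ContDiffOn ℝ 2 κ (Set.Ici 0)) {x t : ℝ} (hx : x ∈ Set.Icc (0:ℝ) 1)
    (ht : t ∈ Set.Icc (0:ℝ) T) :
    HasDerivAt (fun y => fl sol y t) (pdt (en sol) x t) x := by
  have r := sol.smooth_ρ
  have u := sol.smooth_u
  have θ := sol.smooth_θ
  have b0 := sol.smooth_b 0
  have b1 := sol.smooth_b 1
  have w0 := sol.smooth_w 0
  have w1 := sol.smooth_w 1
  have hk : HasDerivAt (fun y => κ (sol.θ y t) * pdx sol.θ y t)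
      (pdx (fun x t => κ (sol.θ x t) * pdx sol.θ x t) x t) x := by
    have h1 : DifferentiableAt ℝ κ (sol.θ x t) :=
      (hκ.contDiffAt (Ici_mem_nhds (sol.θ_pos x hx t ht))).differentiableAt (by simp)
    have h2 : DifferentiableAt ℝ (fun y => κ (sol.θ y t)) x :=
      DifferentiableAt.comp x h1 (Sm.hx θ x t).differentiableAt
    exact (h2.mul (Sm.hx (Sm.pdx θ) x t).differentiableAt).hasDerivAt
  have E1 := massE sol hx ht
  have E2 := sol.eq_mom x hx t ht
  have E30 := sol.eq_w 0 x hx t ht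
  have E31 := sol.eq_w 1 x hx t ht
  have E40 := sol.eq_b 0 x hx t ht
  have E41 := sol.eq_b 1 x hx t ht
  have E5 := sol.eq_θ x hx t ht
  have a1 : pdt (fun x t => sol.ρ x t * sol.u x t) x t = _ :=
    ((Sm.ht r x t).mul (Sm.ht u x t)).deriv
  have a2 : pdx (fun x t => sol.ρ x t * (sol.u x t) ^ 2 + sol.ρ x t * sol.θ x t +
      ((sol.b 0 x t) ^ 2 + (sol.b 1 x t) ^ 2) / 2) x t = _ :=
    ((((Sm.hx r x t).mul ((Sm.hx u x t).pow 2)).add ((Sm.hx r x t).mul (Sm.hx θ x t))).add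
      ((((Sm.hx b0 x t).pow 2).add ((Sm.hx b1 x t).pow 2)).div_const 2)).deriv
  have a30 : pdt (fun x t => sol.ρ x t * sol.w 0 x t) x t = _ :=
    ((Sm.ht r x t).mul (Sm.ht w0 x t)).deriv
  have a31 : pdt (fun x t => sol.ρ x t * sol.w 1 x t) x t = _ :=
    ((Sm.ht r x t).mul (Sm.ht w1 x t)).deriv
  have a40 : pdx (fun x t => sol.ρ x t * sol.u x t * sol.w 0 x t - sol.b 0 x t) x t = _ :=
    ((((Sm.hx r x t).mul (Sm.hx u x t)).mul (Sm.hx w0 x t)).sub (Sm.hx b0 x t)).deriv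
  have a41 : pdx (fun x t => sol.ρ x t * sol.u x t * sol.w 1 x t - sol.b 1 x t) x t = _ :=
    ((((Sm.hx r x t).mul (Sm.hx u x t)).mul (Sm.hx w1 x t)).sub (Sm.hx b1 x t)).deriv
  have a50 : pdx (fun x t => sol.u x t * sol.b 0 x t - sol.w 0 x t) x t = _ :=
    (((Sm.hx u x t).mul (Sm.hx b0 x t)).sub (Sm.hx w0 x t)).deriv
  have a51 : pdx (fun x t => sol.u x t * sol.b 1 x t - sol.w 1 x t) x t = _ :=
    (((Sm.hx u x t).mul (Sm.hx b1 x t)).sub (Sm.hx w1 x t)).deriv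
  have a6 : pdt (fun x t => sol.ρ x t * sol.θ x t) x t = _ :=
    ((Sm.ht r x t).mul (Sm.ht θ x t)).deriv
  have a7 : pdx (fun x t => sol.ρ x t * sol.u x t * sol.θ x t) x t = _ :=
    (((Sm.hx r x t).mul (Sm.hx u x t)).mul (Sm.hx θ x t)).deriv
  simp only [Fin.sum_univ_two] at E2 E5
  rw [a1, a2] at E2
  rw [a30, a40] at E30
  rw [a31, a41] at E31
  rw [a50] at E40
  rw [a51] at E41
  rw [a6, a7] at E5
  have ae : pdt (en sol) x t = _ :=
    ((((Sm.ht r x t).mul (Sm.ht θ x t)).add (((Sm.ht r x t).mul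
      (((Sm.ht u x t).mul (Sm.ht u x t)).add (((Sm.ht w0 x t).mul (Sm.ht w0 x t)).add
      ((Sm.ht w1 x t).mul (Sm.ht w1 x t))))).mul_const 2⁻¹)).add
      ((((Sm.ht b0 x t).mul (Sm.ht b0 x t)).add ((Sm.ht b1 x t).mul (Sm.ht b1 x t))).mul_const
        2⁻¹)).deriv
  have hx1 := ((((Sm.hx r x t).mul (Sm.hx θ x t)).add (((Sm.hx r x t).mul
      (((Sm.hx u x t).mul (Sm.hx u x t)).add (((Sm.hx w0 x t).mul (Sm.hx w0 x t)).add
      ((Sm.hx w1 x t).mul (Sm.hx w1 x t))))).mul_const 2⁻¹)).add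
      ((((Sm.hx b0 x t).mul (Sm.hx b0 x t)).add ((Sm.hx b1 x t).mul (Sm.hx b1 x t))).mul_const
        2⁻¹))
  have hfl := ((((((Sm.hx u x t).mul (Sm.hx (Sm.pdx u) x t)).add
    (((Sm.hx w0 x t).mul (Sm.hx (Sm.pdx w0) x t)).add
      ((Sm.hx w1 x t).mul (Sm.hx (Sm.pdx w1) x t)))).add
    (((Sm.hx b0 x t).mul (Sm.hx (Sm.pdx b0) x t)).add
      ((Sm.hx b1 x t).mul (Sm.hx (Sm.pdx b1) x t)))).add
    (((Sm.hx b0 x t).mul (Sm.hx w0 x t)).add ((Sm.hx b1 x t).mul (Sm.hx w1 x t)))).sub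
    ((Sm.hx u x t).mul (hx1.add (((Sm.hx r x t).mul (Sm.hx θ x t)).add
      ((((Sm.hx b0 x t).mul (Sm.hx b0 x t)).add ((Sm.hx b1 x t).mul (Sm.hx b1 x t))).mul_const
        2⁻¹))))).add hk
  refine HasDerivAt.congr_deriv (f := fun y => fl sol y t) hfl ?_
  rw [ae]
  simp only [Pi.mul_apply, Pi.add_apply, Pi.sub_apply, Pi.pow_apply] at *
  generalize pdx (fun x t => κ (sol.θ x t) * pdx sol.θ x t) x t = KK at *
  norm_num at *
  linear_combination (-1) * E5 - sol.u x t * E2 - sol.w 0 x t * E30 - sol.w 1 x t * E31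
    - sol.b 0 x t * E40 - sol.b 1 x t * E41 + (sol.u x t * sol.u x t + sol.w 0 x t * sol.w 0 x t
      + sol.w 1 x t * sol.w 1 x t) * 2⁻¹ * E1

lemma const_of_flux {f F : ℝ → ℝ → ℝ} (hf : Sm f)
    (hF : ∀ x ∈ Set.Icc (0:ℝ) 1, ∀ t ∈ Set.Icc (0:ℝ) T,
      HasDerivAt (fun y => F y t) (pdt f x t) x)
    (h0 : ∀ t ∈ Set.Icc (0:ℝ) T, F 1 t = F 0 t) {t : ℝ} (ht : t ∈ Set.Icc (0:ℝ) T) :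
    ∫ x in (0:ℝ)..1, f x t = ∫ x in (0:ℝ)..1, f x 0 := by
  have hd : ∀ s ∈ Set.uIcc 0 t, HasDerivAt (fun t => ∫ y in (0:ℝ)..1, f y t) 0 s := by
    intro s hs
    rw [Set.uIcc_of_le ht.1] at hs
    have hs' : s ∈ Set.Icc (0:ℝ) T := ⟨hs.1, hs.2.trans ht.2⟩
    have h1 := hf.integral_deriv 0 1 s
    have h2 : ∫ y in (0:ℝ)..1, pdt f y s = F 1 s - F 0 s := by
      apply intervalIntegral.integral_eq_sub_of_hasDerivAt (f := fun y => F y s)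
      · intro y hy
        rw [Set.uIcc_of_le zero_le_one] at hy
        exact hF y hy s hs'
      · exact hf.pdt.int s 0 1
    rwa [h2, h0 s hs', sub_self] at h1
  have := intervalIntegral.integral_eq_sub_of_hasDerivAt hd (by simp)
  simp only [intervalIntegral.integral_zero] at this
  linarith

lemma energy (hκ : ContDiffOn ℝ 2 κ (Set.Ici 0)) {t : ℝ} (ht : t ∈ Set.Icc (0:ℝ) T) :
    ∫ x in (0:ℝ)..1, en sol x t = ∫ x in (0:ℝ)..1, en sol x 0 := by
  refine const_of_flux (T := T) (smEn sol) (F := fl sol) (fun x hx t ht => fl_x sol hκ hx ht) ?_ ht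
  intro s hs
  simp [fl, (sol.bc_u s hs).1, (sol.bc_u s hs).2, (sol.bc_w 0 s hs).1, (sol.bc_w 0 s hs).2,
    (sol.bc_w 1 s hs).1, (sol.bc_w 1 s hs).2, (sol.bc_b 0 s hs).1, (sol.bc_b 0 s hs).2,
    (sol.bc_b 1 s hs).1, (sol.bc_b 1 s hs).2, (sol.bc_θ s hs).1, (sol.bc_θ s hs).2]

lemma mass {t : ℝ} (ht : t ∈ Set.Icc (0:ℝ) T) :
    ∫ x in (0:ℝ)..1, sol.ρ x t = ∫ x in (0:ℝ)..1, sol.ρ x 0 := by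
  refine const_of_flux (T := T) sol.smooth_ρ (F := fun x t => -(sol.ρ x t * sol.u x t)) ?_ ?_ ht
  · intro x hx s hs
    have := (Sm.hx (smRU sol) x s).neg
    have h := sol.eq_mass x hx s hs
    rw [show pdt sol.ρ x s = - pdx (fun x t => sol.ρ x t * sol.u x t) x s by linarith]
    exact this
  · intro s hs
    simp [(sol.bc_u s hs).1, (sol.bc_u s hs).2]

/-- time part of the potential -/
def cc (t : ℝ) : ℝ :=
  (∫ s in (0:ℝ)..t, ∫ y in (0:ℝ)..1, Psi sol y s)
    - ∫ y in (0:ℝ)..1, (1 - y) * (sol.ρ y t * sol.u y t)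

/-- potential -/
def phi (x t : ℝ) : ℝ := (∫ y in (0:ℝ)..x, sol.ρ y t * sol.u y t) + cc sol t

lemma smOne : Sm (fun y t => (1 - y) * (sol.ρ y t * sol.u y t)) :=
  ContDiff.mul (ContDiff.sub contDiff_const contDiff_fst) (smRU sol)

lemma cc_t {t : ℝ} (ht : t ∈ Set.Icc (0:ℝ) T) : HasDerivAt (cc sol) (Psi sol 0 t) t := by
  have h1 : HasDerivAt (fun t => ∫ s in (0:ℝ)..t, ∫ y in (0:ℝ)..1, Psi sol y s)
      (∫ y in (0:ℝ)..1, Psi sol y t) t := by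
    have hc := (smPsi sol).integral_cont 0 1
    exact intervalIntegral.integral_hasDerivAt_right (hc.intervalIntegrable _ _)
      hc.aestronglyMeasurable.stronglyMeasurableAtFilter hc.continuousAt
  have h2 := (smOne sol).integral_deriv 0 1 t
  have h3 : ∫ y in (0:ℝ)..1, (pdt (fun y t => (1 - y) * (sol.ρ y t * sol.u y t)) y t
      - Psi sol y t) = (1 - 1) * Psi sol 1 t - (1 - 0) * Psi sol 0 t := by
    apply intervalIntegral.integral_eq_sub_of_hasDerivAt (f := fun y => (1 - y) * Psi sol y t)
    · intro y hy
      rw [Set.uIcc_of_le zero_le_one] at hy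
      have e : pdt (fun y t => (1 - y) * (sol.ρ y t * sol.u y t)) y t = _ :=
        ((Sm.ht (smRU sol) y t).const_mul (1 - y)).deriv
      rw [e]
      have := ((hasDerivAt_id y).const_sub 1).mul (Psi_x sol hy ht)
      refine this.congr_deriv ?_
      simp only [id]
      ring
    · exact ((smOne sol).pdt.int t 0 1).sub ((smPsi sol).int t 0 1)
  rw [intervalIntegral.integral_sub ((smOne sol).pdt.int t 0 1) ((smPsi sol).int t 0 1)] at h3
  refine (h1.sub h2).congr_deriv ?_
  linarith

lemma phi_t {x t : ℝ} (hx : x ∈ Set.Icc (0:ℝ) 1) (ht : t ∈ Set.Icc (0:ℝ) T) :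
    HasDerivAt (fun s => phi sol x s) (Psi sol x t) t := by
  have h1 := (smRU sol).integral_deriv 0 x t
  have h2 : ∫ y in (0:ℝ)..x, pdt (fun x t => sol.ρ x t * sol.u x t) y t
      = Psi sol x t - Psi sol 0 t := by
    apply intervalIntegral.integral_eq_sub_of_hasDerivAt (f := fun y => Psi sol y t)
    · intro y hy
      rw [Set.uIcc_of_le hx.1] at hy
      exact Psi_x sol ⟨hy.1, hy.2.trans hx.2⟩ ht
    · exact (smRU sol).pdt.int t 0 x
  refine (h1.add (cc_t sol ht)).congr_deriv ?_
  linarith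

lemma phi_x (x t : ℝ) : HasDerivAt (fun y => phi sol y t) (sol.ρ x t * sol.u x t) x := by
  have hc := (smRU sol).cx t
  exact (intervalIntegral.integral_hasDerivAt_right (hc.intervalIntegrable _ _)
      hc.aestronglyMeasurable.stronglyMeasurableAtFilter hc.continuousAt).add_const _

lemma phi_cont : Continuous (Function.uncurry (phi sol)) := by
  have h1 : Continuous (cc sol) := by
    apply Continuous.sub
    · exact intervalIntegral.continuous_primitive
        (fun a b => ((smPsi sol).integral_cont 0 1).intervalIntegrable a b) 0
    · exact (smOne sol).integral_cont 0 1
  have h2 : Continuous fun p : ℝ × ℝ => ∫ y in (0:ℝ)..p.1, sol.ρ y p.2 * sol.u y p.2 := by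
    apply intervalIntegral.continuous_parametric_intervalIntegral_of_continuous
      (f := fun (p : ℝ × ℝ) y => sol.ρ y p.2 * sol.u y p.2)
    · exact (smRU sol).continuous.comp
        (by fun_prop : Continuous fun p : (ℝ × ℝ) × ℝ => (p.2, p.1.2))
    · exact continuous_fst
  exact h2.add (h1.comp continuous_snd)

lemma en_lower {x t : ℝ} (hx : x ∈ Set.Icc (0:ℝ) 1) (ht : t ∈ Set.Icc (0:ℝ) T) :
    0 ≤ sol.ρ x t * (sol.u x t) ^ 2 + sol.ρ x t * sol.θ x t + (∑ i, (sol.b i x t) ^ 2) / 2 ∧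
    sol.ρ x t * (sol.u x t) ^ 2 + sol.ρ x t * sol.θ x t + (∑ i, (sol.b i x t) ^ 2) / 2
      ≤ 2 * en sol x t ∧
    |sol.ρ x t * sol.u x t| ≤ sol.ρ x t + en sol x t := by
  have hr := sol.ρ_pos x hx t ht
  have hθ := sol.θ_pos x hx t ht
  have p1 : 0 < sol.ρ x t * sol.θ x t := mul_pos hr hθ
  have p2 : 0 ≤ sol.ρ x t * (sol.u x t) ^ 2 := mul_nonneg hr.le (sq_nonneg _)
  have p3 : 0 ≤ sol.ρ x t * (sol.w 0 x t) ^ 2 := mul_nonneg hr.le (sq_nonneg _)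
  have p4 : 0 ≤ sol.ρ x t * (sol.w 1 x t) ^ 2 := mul_nonneg hr.le (sq_nonneg _)
  have p5 := sq_nonneg (sol.b 0 x t)
  have p6 := sq_nonneg (sol.b 1 x t)
  have p7 : 0 ≤ sol.ρ x t * (|sol.u x t| - 1) ^ 2 := mul_nonneg hr.le (sq_nonneg _)
  simp only [Fin.sum_univ_two, en]
  refine ⟨by positivity, by nlinarith, ?_⟩
  rw [abs_mul, abs_of_pos hr]
  nlinarith [sq_abs (sol.u x t)]

lemma ru_bound {m E x t : ℝ} (hx : x ∈ Set.Icc (0:ℝ) 1) (ht : t ∈ Set.Icc (0:ℝ) T)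
    (hm : ∫ x in (0:ℝ)..1, sol.ρ x t ≤ m) (hE : ∫ x in (0:ℝ)..1, en sol x t ≤ E)
    {k : ℝ → ℝ} (hk : ∀ y ∈ Set.Icc (0:ℝ) 1, |k y| ≤ 1) :
    |∫ y in (0:ℝ)..x, k y * (sol.ρ y t * sol.u y t)| ≤ m + E := by
  have hs := (Sm.add sol.smooth_ρ (smEn sol)).int t
  have h1 : ‖∫ y in (0:ℝ)..x, k y * (sol.ρ y t * sol.u y t)‖ ≤
      ∫ y in (0:ℝ)..x, (sol.ρ y t + en sol y t) := by
    apply intervalIntegral.norm_integral_le_of_norm_le hx.1 _ (hs 0 x)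
    refine Filter.Eventually.of_forall fun y hy => ?_
    have hy' : y ∈ Set.Icc (0:ℝ) 1 := ⟨hy.1.le, hy.2.trans hx.2⟩
    have h2 := (en_lower sol hy' ht).2.2
    rw [Real.norm_eq_abs, abs_mul]
    nlinarith [hk y hy', abs_nonneg (sol.ρ y t * sol.u y t), abs_nonneg (k y)]
  have h2 : ∫ y in (0:ℝ)..x, (sol.ρ y t + en sol y t) ≤
      ∫ y in (0:ℝ)..1, (sol.ρ y t + en sol y t) := by
    apply intervalIntegral.integral_mono_interval le_rfl hx.1 hx.2 _ (hs 0 1)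
    refine (ae_restrict_iff' measurableSet_Ioc).2 (Filter.Eventually.of_forall fun y hy => ?_)
    have h2 := (en_lower sol ⟨hy.1.le, hy.2⟩ ht).2.2
    exact le_trans (abs_nonneg _) h2
  rw [intervalIntegral.integral_add (Sm.int sol.smooth_ρ t 0 1) ((smEn sol).int t 0 1)] at h2
  rw [Real.norm_eq_abs] at h1
  linarith

lemma psi_bound {E t : ℝ} (ht : t ∈ Set.Icc (0:ℝ) T)
    (hE : ∫ x in (0:ℝ)..1, en sol x t ≤ E) :
    |∫ y in (0:ℝ)..1, Psi sol y t| ≤ 2 * E := by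
  have h0 : ∫ y in (0:ℝ)..1, pdx sol.u y t = 0 := by
    rw [intervalIntegral.integral_eq_sub_of_hasDerivAt (f := fun y => sol.u y t)
      (fun y _ => Sm.hx sol.smooth_u y t) ((Sm.pdx sol.smooth_u).int t 0 1),
      (sol.bc_u t ht).1, (sol.bc_u t ht).2, sub_zero]
  have h1 : ∫ y in (0:ℝ)..1, Psi sol y t = 0 - _ :=
    (intervalIntegral.integral_sub ((Sm.pdx sol.smooth_u).int t 0 1)
      ((smFlux sol).int t 0 1)).trans (by rw [h0])
  rw [h1, zero_sub, abs_neg, abs_of_nonneg]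
  · refine le_trans (intervalIntegral.integral_mono_on zero_le_one ((smFlux sol).int t 0 1)
      (((smEn sol).int t 0 1).const_mul 2) (fun y hy => (en_lower sol hy ht).2.1)) ?_
    rw [intervalIntegral.integral_const_mul]
    linarith
  · exact intervalIntegral.integral_nonneg zero_le_one (fun y hy => (en_lower sol hy ht).1)

lemma phi_bound {m E x t : ℝ} (hx : x ∈ Set.Icc (0:ℝ) 1) (ht : t ∈ Set.Icc (0:ℝ) T)
    (hm : ∀ t ∈ Set.Icc (0:ℝ) T, ∫ x in (0:ℝ)..1, sol.ρ x t ≤ m)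
    (hE : ∀ t ∈ Set.Icc (0:ℝ) T, ∫ x in (0:ℝ)..1, en sol x t ≤ E) :
    |phi sol x t| ≤ 2 * (m + E) + 2 * E * T := by
  have h1 := ru_bound sol hx ht (hm t ht) (hE t ht) (k := fun _ => 1) (by simp)
  have h2 := ru_bound sol (x := 1) (by simp) ht (hm t ht) (hE t ht) (k := fun y => 1 - y) (by
    intro y hy
    rw [abs_le]
    constructor <;> linarith [hy.1, hy.2])
  simp only [one_mul] at h1
  have h3 : ‖∫ s in (0:ℝ)..t, ∫ y in (0:ℝ)..1, Psi sol y s‖ ≤ 2 * E * |t - 0| := by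
    apply intervalIntegral.norm_integral_le_of_norm_le_const
    intro s hs
    rw [Set.uIoc_of_le ht.1] at hs
    have hs' : s ∈ Set.Icc (0:ℝ) T := ⟨hs.1.le, hs.2.trans ht.2⟩
    exact psi_bound sol hs' (hE s hs')
  have hE0 : 0 ≤ 2 * E := le_trans (abs_nonneg _) (psi_bound sol ht (hE t ht))
  rw [sub_zero, abs_of_nonneg ht.1, Real.norm_eq_abs] at h3
  have h4 : 2 * E * t ≤ 2 * E * T := mul_le_mul_of_nonneg_left ht.2 hE0
  unfold phi cc
  rw [abs_le] at *
  constructor <;> linarith [h1.1, h1.2, h2.1, h2.2, h3.1, h3.2]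

lemma main_bound (hT : 0 < T) {L K : ℝ}
    (hphi : ∀ x ∈ Set.Icc (0:ℝ) 1, ∀ t ∈ Set.Icc (0:ℝ) T, |phi sol x t| ≤ L)
    (hK : ∀ x ∈ Set.Icc (0:ℝ) 1, sol.ρ x 0 ≤ K) (hK0 : 0 ≤ K) :
    ∀ x ∈ Set.Icc (0:ℝ) 1, ∀ t ∈ Set.Icc (0:ℝ) T, sol.ρ x t ≤ K * Real.exp (2 * L) := by
  have key : ∀ x ∈ Set.Icc (0:ℝ) 1, ∀ t ∈ Set.Icc (0:ℝ) T,
      sol.ρ x t * Real.exp (phi sol x t) ≤ K * Real.exp L := by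
    refine max_principle hT (g := fun x t => sol.ρ x t * Real.exp (phi sol x t))
      (gx := fun x t => pdx sol.ρ x t * Real.exp (phi sol x t)
        + sol.ρ x t * (Real.exp (phi sol x t) * (sol.ρ x t * sol.u x t)))
      (gt := fun x t => pdt sol.ρ x t * Real.exp (phi sol x t)
        + sol.ρ x t * (Real.exp (phi sol x t) * Psi sol x t)) (u := sol.u) ?_ ?_ ?_ sol.bc_u ?_ ?_
    · exact (sol.smooth_ρ.continuous.mul
        (Real.continuous_exp.comp (phi_cont sol))).continuousOn
    · intro x hx t ht
      exact (Sm.hx sol.smooth_ρ x t).mul (phi_x sol x t).exp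
    · intro x hx t ht
      exact (Sm.ht sol.smooth_ρ x t).mul (phi_t sol hx ht).exp
    · intro x hx t ht
      have h1 := massE sol hx ht
      have hr := sol.ρ_pos x hx t ht
      have hθ := sol.θ_pos x hx t ht
      have e : pdt sol.ρ x t * Real.exp (phi sol x t)
          + sol.ρ x t * (Real.exp (phi sol x t) * Psi sol x t)
          + sol.u x t * (pdx sol.ρ x t * Real.exp (phi sol x t)
          + sol.ρ x t * (Real.exp (phi sol x t) * (sol.ρ x t * sol.u x t)))
          = - (sol.ρ x t * Real.exp (phi sol x t) *
            (sol.ρ x t * sol.θ x t + (∑ i, (sol.b i x t) ^ 2) / 2)) := by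
        unfold Psi
        linear_combination Real.exp (phi sol x t) * h1
      show _ ≤ (0:ℝ)
      rw [e]
      have : 0 ≤ ∑ i, (sol.b i x t) ^ 2 := Finset.sum_nonneg fun i _ => sq_nonneg _
      have := Real.exp_pos (phi sol x t)
      rw [neg_nonpos]
      positivity
    · intro x hx
      have h0 : (0:ℝ) ∈ Set.Icc (0:ℝ) T := ⟨le_rfl, hT.le⟩
      exact mul_le_mul (hK x hx) (Real.exp_le_exp.2 ((le_abs_self _).trans (hphi x hx 0 h0)))
        (Real.exp_pos _).le hK0
  intro x hx t ht
  have h1 := key x hx t ht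
  have h2 : Real.exp (-L) ≤ Real.exp (phi sol x t) :=
    Real.exp_le_exp.2 (neg_le_of_abs_le (hphi x hx t ht))
  have h3 : sol.ρ x t * Real.exp (-L) ≤ K * Real.exp L :=
    le_trans (mul_le_mul_of_nonneg_left h2 (sol.ρ_pos x hx t ht).le) h1
  calc sol.ρ x t = sol.ρ x t * Real.exp (-L) * Real.exp L := by
        rw [mul_assoc, ← Real.exp_add]; simp
    _ ≤ K * Real.exp L * Real.exp L := mul_le_mul_of_nonneg_right h3 (Real.exp_pos _).le
    _ = K * Real.exp (2 * L) := by rw [mul_assoc, ← Real.exp_add]; ring_nf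

lemma init_bound {A B M : ℝ} (hT : 0 < T) (h : InitBounds sol A B M) :
    (∀ x ∈ Set.Icc (0:ℝ) 1, sol.ρ x 0 ≤ 1 + A ^ 2) ∧
    (∫ x in (0:ℝ)..1, sol.ρ x 0) ≤ 1 + A ^ 2 ∧
    (∫ x in (0:ℝ)..1, en sol x 0) ≤ 4 * (1 + A ^ 2) ^ 3 := by
  obtain ⟨hr, hu, hθ, hw, hb, -, -⟩ := h
  have S : ∀ {f : ℝ → ℝ → ℝ}, Sm f → ContDiff ℝ (⊤ : ℕ∞) (fun x => f x 0) := fun hf =>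
    ContDiff.comp hf (contDiff_id.prodMk contDiff_const)
  have hr1 : ∀ x ∈ Set.Icc (0:ℝ) 1, sol.ρ x 0 ≤ 1 + A ^ 2 := fun x hx =>
    (le_abs_self _).trans (sup_bound (S sol.smooth_ρ) hr hx)
  refine ⟨hr1, ?_, ?_⟩
  · have := intervalIntegral.integral_mono_on zero_le_one (Sm.int sol.smooth_ρ 0 0 1)
      (intervalIntegrable_const (c := 1 + A ^ 2)) hr1
    simpa using this
  · have := intervalIntegral.integral_mono_on zero_le_one ((smEn sol).int 0 0 1)
      (intervalIntegrable_const (c := 4 * (1 + A ^ 2) ^ 3)) (fun x hx => ?_)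
    · simpa using this
    have q : ∀ {f : ℝ → ℝ → ℝ}, Sm f → H2norm (fun x => f x 0) ≤ A →
        f x 0 * f x 0 ≤ (1 + A ^ 2) ^ 2 := by
      intro f hf hA
      have h1 := sup_bound (S hf) hA hx
      have h2 := abs_mul_abs_self (f x 0)
      nlinarith [abs_nonneg (f x 0)]
    have u1 := q sol.smooth_u hu
    have w0 := q (sol.smooth_w 0) (hw 0)
    have w1 := q (sol.smooth_w 1) (hw 1)
    have b0 := q (sol.smooth_b 0) (hb 0)
    have b1 := q (sol.smooth_b 1) (hb 1)
    have θ1 := (le_abs_self _).trans (sup_bound (S sol.smooth_θ) hθ hx)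
    have r1 := hr1 x hx
    have rp := sol.ρ_pos x hx 0 ⟨le_rfl, hT.le⟩
    have θp := sol.θ_pos x hx 0 ⟨le_rfl, hT.le⟩
    have hK : 1 ≤ 1 + A ^ 2 := by nlinarith [sq_nonneg A]
    unfold en
    generalize 1 + A ^ 2 = K at *
    have e1 : sol.ρ x 0 * sol.θ x 0 ≤ K * K := mul_le_mul r1 θ1 θp.le (by linarith)
    have e2 : sol.ρ x 0 * (sol.u x 0 * sol.u x 0 + (sol.w 0 x 0 * sol.w 0 x 0
        + sol.w 1 x 0 * sol.w 1 x 0)) ≤ K * (3 * K ^ 2) :=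
      mul_le_mul r1 (by linarith) (add_nonneg (mul_self_nonneg _)
        (add_nonneg (mul_self_nonneg _) (mul_self_nonneg _))) (by linarith)
    have e3 : K ^ 2 ≤ K ^ 3 := pow_le_pow_right₀ hK (by norm_num)
    nlinarith

end

end MHDaux

/-- Lemma 2.2: there is a constant `C` depending only on `T, q, C₀`
and on the initial data (upper bound `A` for the `H²` norms, upper bound `B` for
`∫₀¹ ρ₀(|ln ρ₀| + |ln θ₀|) dx`, positive lower bound `M` for `∫₀¹ ρ₀ dx`), but not on
the pointwise lower bounds of `ρ₀` and `θ₀`, such that every smooth solution satisfies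
`0 ≤ ρ(x,t) ≤ C` on `Q_T`. -/
theorem stmt8 (T q C₀ : ℝ) (hT : 0 < T) (hq : 0 < q) (hC₀ : 1 ≤ C₀)
    (κ : ℝ → ℝ) (hκ : KappaHyp q C₀ κ) (A B M : ℝ) (hM : 0 < M) :
    ∃ C : ℝ, 0 < C ∧ ∀ sol : MHDSol T κ, InitBounds sol A B M →
      ∀ x ∈ Set.Icc (0:ℝ) 1, ∀ t ∈ Set.Icc (0:ℝ) T,
        0 ≤ sol.ρ x t ∧ sol.ρ x t ≤ C := by
  refine ⟨(1 + A ^ 2) * Real.exp (2 * (2 * ((1 + A ^ 2) + 4 * (1 + A ^ 2) ^ 3)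
    + 2 * (4 * (1 + A ^ 2) ^ 3) * T)), by positivity, ?_⟩
  intro sol hI x hx t ht
  refine ⟨(sol.ρ_pos x hx t ht).le, ?_⟩
  obtain ⟨h1, h2, h3⟩ := MHDaux.init_bound sol hT hI
  refine MHDaux.main_bound sol hT (fun x hx t ht => MHDaux.phi_bound sol hx ht ?_ ?_) h1
    (by positivity) x hx t ht
  · intro s hs
    rw [MHDaux.mass sol hs]
    exact h2
  · intro s hs
    rw [MHDaux.energy sol hκ.1 hs]
    exact h3
end
end

section
/- Let α be any constant with 0 < α < min{1, q}. There exists a constant C depending only on α, T, q, C₀ and on the initial data ρ₀,u₀,w₀,b₀,θ₀ — specifically on upper bounds for their H²((0,1))-norms, an upper bound for ∫₀¹ ρ₀(|ln ρ₀| + |ln θ₀|) dx, and a positive lower bound for ∫₀¹ ρ₀ dx — but not on the pointwise lower bounds of ρ₀ and θ₀, such that every smooth solution (ρ,u,w,b,θ) of the planar compressible MHD system on Q_T satisfies ∬_{Q_T} [ (u_x² + |w_x|² + |b_x|²)/θ^α + (1 + θ^q) θ_x²/θ^{1+α} ] dx dt ≤ C. -/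
open Real MeasureTheory Set

noncomputable section

/-- Smooth field. -/
def Sm (f : ℝ → ℝ → ℝ) : Prop := ContDiff ℝ (⊤ : ℕ∞) (Function.uncurry f)

lemma Sm.hasX {f : ℝ → ℝ → ℝ} (hf : Sm f) (x t : ℝ) :
    HasDerivAt (fun y => f y t) (pdx f x t) x := by
  have hd : DifferentiableAt ℝ (fun y => f y t) x := by
    have h1 : Differentiable ℝ (Function.uncurry f) := ContDiff.differentiable hf (by simp)
    have h2 : (fun y => f y t) = Function.uncurry f ∘ (fun y => (y, t)) := rfl
    rw [h2]
    exact (h1 _).comp x (by fun_prop)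
  exact hd.hasDerivAt

lemma Sm.hasT {f : ℝ → ℝ → ℝ} (hf : Sm f) (x t : ℝ) :
    HasDerivAt (fun s => f x s) (pdt f x t) t := by
  have hd : DifferentiableAt ℝ (fun y => f x y) t := by
    have h1 : Differentiable ℝ (Function.uncurry f) := ContDiff.differentiable hf (by simp)
    have h2 : (fun y => f x y) = Function.uncurry f ∘ (fun y => (x, y)) := rfl
    rw [h2]
    exact (h1 _).comp t (by fun_prop)
  exact hd.hasDerivAt

lemma Sm.dx {f : ℝ → ℝ → ℝ} (hf : Sm f) : Sm (pdx f) := by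
  have h1 : Differentiable ℝ (Function.uncurry f) := ContDiff.differentiable hf (by simp)
  have h : Function.uncurry (pdx f) = fun p => fderiv ℝ (Function.uncurry f) p (1, 0) := by
    ext ⟨x, t⟩
    have h3 : HasDerivAt (fun y : ℝ => (y, t)) ((1:ℝ), (0:ℝ)) x :=
      (hasDerivAt_id x).prodMk (hasDerivAt_const x t)
    have h2 := (h1 (x, t)).hasFDerivAt.comp_hasDerivAt x h3
    exact (hf.hasX x t).unique h2
  unfold Sm
  rw [h]
  exact (ContDiff.fderiv_right hf (by simp)).clm_apply contDiff_const

lemma Sm.dt {f : ℝ → ℝ → ℝ} (hf : Sm f) : Sm (pdt f) := by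
  have h1 : Differentiable ℝ (Function.uncurry f) := ContDiff.differentiable hf (by simp)
  have h : Function.uncurry (pdt f) = fun p => fderiv ℝ (Function.uncurry f) p (0, 1) := by
    ext ⟨x, t⟩
    have h3 : HasDerivAt (fun y : ℝ => (x, y)) ((0:ℝ), (1:ℝ)) t :=
      (hasDerivAt_const t x).prodMk (hasDerivAt_id t)
    have h2 := (h1 (x, t)).hasFDerivAt.comp_hasDerivAt t h3
    exact (hf.hasT x t).unique h2
  unfold Sm
  rw [h]
  exact (ContDiff.fderiv_right hf (by simp)).clm_apply contDiff_const

lemma Sm.cont {f : ℝ → ℝ → ℝ} (hf : Sm f) : Continuous (fun p : ℝ × ℝ => f p.1 p.2) :=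
  ContDiff.continuous hf

lemma Sm.cont2 {X : Type*} [TopologicalSpace X] {f : ℝ → ℝ → ℝ} (hf : Sm f) {a b : X → ℝ}
    (ha : Continuous a) (hb : Continuous b) : Continuous (fun p : X => f (a p) (b p)) :=
  hf.cont.comp (ha.prodMk hb)

lemma sliceX {f : ℝ → ℝ → ℝ} {τ t : ℝ} (ht : t ∈ Icc (0:ℝ) τ)
    (cf : ContinuousOn (fun p : ℝ × ℝ => f p.1 p.2) (Icc (0:ℝ) 1 ×ˢ Icc (0:ℝ) τ)) :
    ContinuousOn (fun x => f x t) (Icc (0:ℝ) 1) :=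
  cf.comp (f := fun x : ℝ => (x, t)) (by fun_prop) (fun _ hx => ⟨hx, ht⟩)

lemma sliceT {f : ℝ → ℝ → ℝ} {τ x : ℝ} (hx : x ∈ Icc (0:ℝ) 1)
    (cf : ContinuousOn (fun p : ℝ × ℝ => f p.1 p.2) (Icc (0:ℝ) 1 ×ˢ Icc (0:ℝ) τ)) :
    ContinuousOn (fun t => f x t) (Icc (0:ℝ) τ) :=
  cf.comp (f := fun t : ℝ => (x, t)) (by fun_prop) (fun _ ht => ⟨hx, ht⟩)

lemma ii01 {f : ℝ → ℝ} {a b : ℝ} (hab : a ≤ b) (cf : ContinuousOn f (Icc a b)) :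
    IntervalIntegrable f volume a b :=
  ContinuousOn.intervalIntegrable (by rwa [uIcc_of_le hab])

/-- FTC on a closed interval. -/
lemma ftc {f f' : ℝ → ℝ} {a b : ℝ} (hab : a ≤ b)
    (hf : ∀ x ∈ Icc a b, HasDerivAt f (f' x) x) (cf : ContinuousOn f' (Icc a b)) :
    ∫ x in a..b, f' x = f b - f a := by
  apply intervalIntegral.integral_eq_sub_of_hasDerivAt
  · intro x hx
    rw [uIcc_of_le hab] at hx
    exact hf x hx
  · exact ii01 hab cf

lemma swap2 {f : ℝ → ℝ → ℝ} {τ : ℝ} (hτ : 0 ≤ τ)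
    (cf : ContinuousOn (fun p : ℝ × ℝ => f p.1 p.2) (Icc (0:ℝ) 1 ×ˢ Icc (0:ℝ) τ)) :
    (∫ x in (0:ℝ)..1, ∫ t in (0:ℝ)..τ, f x t) = ∫ t in (0:ℝ)..τ, ∫ x in (0:ℝ)..1, f x t := by
  apply MeasureTheory.intervalIntegral_intervalIntegral_swap
  rw [uIoc_of_le zero_le_one, uIoc_of_le hτ]
  have h : IntegrableOn (Function.uncurry f) (Icc (0:ℝ) 1 ×ˢ Icc (0:ℝ) τ)
      ((volume : Measure ℝ).prod (volume : Measure ℝ)) :=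
    ContinuousOn.integrableOn_compact (isCompact_Icc.prod isCompact_Icc) cf
  exact h.mono_set (prod_mono Ioc_subset_Icc_self Ioc_subset_Icc_self)

/-- The function `t ↦ ∫₀¹ f x t dx` is interval integrable. -/
lemma ii_param {f : ℝ → ℝ → ℝ} {τ : ℝ} (hτ : 0 ≤ τ)
    (cf : ContinuousOn (fun p : ℝ × ℝ => f p.1 p.2) (Icc (0:ℝ) 1 ×ˢ Icc (0:ℝ) τ)) :
    IntervalIntegrable (fun t => ∫ x in (0:ℝ)..1, f x t) volume 0 τ := by
  have h : IntegrableOn (Function.uncurry f) (Icc (0:ℝ) 1 ×ˢ Icc (0:ℝ) τ)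
      ((volume : Measure ℝ).prod (volume : Measure ℝ)) :=
    ContinuousOn.integrableOn_compact (isCompact_Icc.prod isCompact_Icc) cf
  have h2 := h.mono_set (prod_mono (Ioc_subset_Icc_self (a := (0:ℝ)) (b := 1))
    (Ioc_subset_Icc_self (a := (0:ℝ)) (b := τ)))
  rw [IntegrableOn, ← Measure.prod_restrict] at h2
  rw [intervalIntegrable_iff_integrableOn_Ioc_of_le hτ]
  simp only [intervalIntegral.integral_of_le (zero_le_one (α := ℝ))]
  exact h2.integral_prod_right

/-- Balance law. -/
lemma balance {τ : ℝ} (hτ : 0 ≤ τ) (f ft h g : ℝ → ℝ → ℝ)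
    (hf : ∀ x ∈ Icc (0:ℝ) 1, ∀ t ∈ Icc (0:ℝ) τ, HasDerivAt (fun s => f x s) (ft x t) t)
    (hh : ∀ x ∈ Icc (0:ℝ) 1, ∀ t ∈ Icc (0:ℝ) τ,
      HasDerivAt (fun y => h y t) (g x t - ft x t) x)
    (cf : ContinuousOn (fun p : ℝ × ℝ => f p.1 p.2) (Icc (0:ℝ) 1 ×ˢ Icc (0:ℝ) τ))
    (cft : ContinuousOn (fun p : ℝ × ℝ => ft p.1 p.2) (Icc (0:ℝ) 1 ×ˢ Icc (0:ℝ) τ))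
    (cg : ContinuousOn (fun p : ℝ × ℝ => g p.1 p.2) (Icc (0:ℝ) 1 ×ˢ Icc (0:ℝ) τ))
    (h0 : ∀ t ∈ Icc (0:ℝ) τ, h 0 t = 0) (h1 : ∀ t ∈ Icc (0:ℝ) τ, h 1 t = 0) :
    (∫ x in (0:ℝ)..1, f x τ) = (∫ x in (0:ℝ)..1, f x 0)
      + ∫ t in (0:ℝ)..τ, ∫ x in (0:ℝ)..1, g x t := by
  have e1 : ∫ x in (0:ℝ)..1, (f x τ - f x 0) = ∫ x in (0:ℝ)..1, ∫ t in (0:ℝ)..τ, ft x t := by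
    apply intervalIntegral.integral_congr
    intro x hx
    rw [uIcc_of_le zero_le_one] at hx
    exact (ftc hτ (hf x hx) (sliceT hx cft)).symm
  rw [swap2 hτ cft, intervalIntegral.integral_sub (ii01 zero_le_one (sliceX ⟨hτ, le_rfl⟩ cf))
    (ii01 zero_le_one (sliceX ⟨le_rfl, hτ⟩ cf))] at e1
  have e2 : ∫ t in (0:ℝ)..τ, ∫ x in (0:ℝ)..1, ft x t
      = ∫ t in (0:ℝ)..τ, ∫ x in (0:ℝ)..1, g x t := by
    apply intervalIntegral.integral_congr
    intro t ht
    rw [uIcc_of_le hτ] at ht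
    have c1 := sliceX ht cft
    have c2 := sliceX ht cg
    have := ftc (zero_le_one) (fun x hx => hh x hx t ht) (c2.sub c1)
    rw [h0 t ht, h1 t ht, intervalIntegral.integral_sub (ii01 zero_le_one c2)
      (ii01 zero_le_one c1)] at this
    show ∫ x in (0:ℝ)..1, ft x t = ∫ x in (0:ℝ)..1, g x t
    linarith
  linarith

/-- Weighted minimum. -/
lemma exists_le_avg {r f : ℝ → ℝ} (cr : ContinuousOn r (Icc (0:ℝ) 1))
    (cf : ContinuousOn f (Icc (0:ℝ) 1)) (hr : ∀ x ∈ Icc (0:ℝ) 1, 0 ≤ r x) :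
    ∃ y ∈ Icc (0:ℝ) 1, f y * (∫ x in (0:ℝ)..1, r x) ≤ ∫ x in (0:ℝ)..1, r x * f x := by
  obtain ⟨y, hy, hmin⟩ := isCompact_Icc.exists_isMinOn (nonempty_Icc.2 zero_le_one) cf
  refine ⟨y, hy, ?_⟩
  rw [← intervalIntegral.integral_const_mul]
  apply intervalIntegral.integral_mono_on zero_le_one
  · exact ii01 zero_le_one (continuousOn_const.mul cr)
  · exact ii01 zero_le_one (cr.mul cf)
  · intro x hx
    have := hmin hx
    simp only [mem_ofPred_eq] at this
    rw [mul_comm]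
    exact mul_le_mul_of_nonneg_left this (hr x hx)

/-- Oscillation control: if `|f'| ≤ g` then `f x ≤ f y + ∫ g`. -/
lemma osc {f f' g : ℝ → ℝ} (hf : ∀ x ∈ Icc (0:ℝ) 1, HasDerivAt f (f' x) x)
    (cf' : ContinuousOn f' (Icc (0:ℝ) 1)) (cg : ContinuousOn g (Icc (0:ℝ) 1))
    (hg : ∀ x ∈ Icc (0:ℝ) 1, |f' x| ≤ g x) {x y : ℝ} (hx : x ∈ Icc (0:ℝ) 1)
    (hy : y ∈ Icc (0:ℝ) 1) : f x ≤ f y + ∫ z in (0:ℝ)..1, g z := by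
  have key : ∀ a b : ℝ, a ∈ Icc (0:ℝ) 1 → b ∈ Icc (0:ℝ) 1 → a ≤ b →
      |f b - f a| ≤ ∫ z in (0:ℝ)..1, g z := by
    intro a b ha hb hab
    have hs : Icc a b ⊆ Icc (0:ℝ) 1 := Icc_subset_Icc ha.1 hb.2
    rw [← ftc hab (fun z hz => hf z (hs hz)) (cf'.mono hs)]
    calc |∫ z in a..b, f' z| ≤ ∫ z in a..b, |f' z| :=
          intervalIntegral.abs_integral_le_integral_abs hab
      _ ≤ ∫ z in a..b, g z := by
          apply intervalIntegral.integral_mono_on hab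
          · exact ii01 hab (cf'.mono hs).abs
          · exact ii01 hab (cg.mono hs)
          · exact fun z hz => hg z (hs hz)
      _ ≤ ∫ z in (0:ℝ)..1, g z := by
          apply intervalIntegral.integral_mono_interval ha.1 hab hb.2
          · rw [Filter.EventuallyLE, ae_restrict_iff' measurableSet_Ioc]
            exact Filter.Eventually.of_forall (fun z hz =>
              (abs_nonneg _).trans (hg z (Ioc_subset_Icc_self hz)))
          · exact ii01 zero_le_one cg
  rcases le_total x y with h | h
  · have := abs_le.1 (key x y hx hy h)
    linarith [this.1]
  · have := abs_le.1 (key y x hy hx h)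
    linarith [this.2]

/-- Sobolev embedding for initial data. -/
lemma sup_of_H2 {f : ℝ → ℝ} (hf : ContDiff ℝ (⊤ : ℕ∞) f) {A : ℝ} (hA : H2norm f ≤ A)
    {x : ℝ} (hx : x ∈ Icc (0:ℝ) 1) : (f x) ^ 2 ≤ 2 * A ^ 2 := by
  have cf : Continuous f := hf.continuous
  have d1 : ContDiff ℝ (⊤ : ℕ∞) (deriv f) := by
    exact ((contDiff_succ_iff_deriv (n := (⊤ : ℕ∞))).1 (by simpa using hf)).2.2
  have d2 : ContDiff ℝ (⊤ : ℕ∞) (deriv (deriv f)) := by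
    exact ((contDiff_succ_iff_deriv (n := (⊤ : ℕ∞))).1 (by simpa using d1)).2.2
  have c1 := d1.continuous
  have c2 := d2.continuous
  have I : ∀ g : ℝ → ℝ, Continuous g → IntervalIntegrable g volume 0 1 :=
    fun g hg => hg.intervalIntegrable _ _
  have hI : ∫ x in (0:ℝ)..1, ((f x) ^ 2 + (deriv f x) ^ 2) ≤ A ^ 2 := by
    have h0 : 0 ≤ ∫ x in (0:ℝ)..1, (f x) ^ 2 + (deriv f x) ^ 2 + (deriv (deriv f) x) ^ 2 :=
      intervalIntegral.integral_nonneg zero_le_one (fun x _ => by positivity)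
    have h1 : ∫ x in (0:ℝ)..1, (f x) ^ 2 + (deriv f x) ^ 2 + (deriv (deriv f) x) ^ 2 ≤ A ^ 2 := by
      have hA0 : 0 ≤ A := (Real.sqrt_nonneg _).trans hA
      exact (Real.sqrt_le_left hA0).1 hA
    refine le_trans ?_ h1
    apply intervalIntegral.integral_mono_on zero_le_one (I _ (by fun_prop)) (I _ (by fun_prop))
    intro x _
    nlinarith [sq_nonneg (deriv (deriv f) x)]
  have hI2 : ∫ x in (0:ℝ)..1, 1 * (f x) ^ 2 ≤ A ^ 2 := by
    refine le_trans ?_ hI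
    apply intervalIntegral.integral_mono_on zero_le_one (I _ (by fun_prop)) (I _ (by fun_prop))
    intro x _
    nlinarith [sq_nonneg (deriv f x)]
  obtain ⟨y, hy, hyle⟩ := exists_le_avg (r := fun _ => 1) (f := fun x => (f x) ^ 2)
    (by fun_prop) (by fun_prop) (fun _ _ => zero_le_one)
  have := osc (f := fun x => (f x) ^ 2) (f' := fun x => 2 * f x * deriv f x)
    (g := fun x => (f x) ^ 2 + (deriv f x) ^ 2)
    (fun z _ => by
      have hd : HasDerivAt f (deriv f z) z := (hf.differentiable (by simp) z).hasDerivAt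
      exact (hd.pow 2).congr_deriv (by simp)) (by fun_prop) (by fun_prop)
    (fun z _ => by
      rw [abs_le]; constructor <;> nlinarith [sq_nonneg (f z - deriv f z), sq_nonneg (f z + deriv f z)])
    hx hy
  simp at hyle this
  simp at hI2
  linarith

section fields

variable {T : ℝ} {κ : ℝ → ℝ}

lemma pt_mass (sol : MHDSol T κ) {x t : ℝ} (hx : x ∈ Icc (0:ℝ) 1) (ht : t ∈ Icc (0:ℝ) T) :
    pdt sol.ρ x t + (pdx sol.ρ x t * sol.u x t + sol.ρ x t * pdx sol.u x t) = 0 := by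
  have h := sol.eq_mass x hx t ht
  have hρ : Sm sol.ρ := sol.smooth_ρ
  have hu : Sm sol.u := sol.smooth_u
  have e : pdx (fun x t => sol.ρ x t * sol.u x t) x t = _ :=
    ((hρ.hasX x t).fun_mul (hu.hasX x t)).deriv
  rw [e] at h
  exact h

lemma pt_mom (sol : MHDSol T κ) {x t : ℝ} (hx : x ∈ Icc (0:ℝ) 1) (ht : t ∈ Icc (0:ℝ) T) :
    (pdt sol.ρ x t * sol.u x t + sol.ρ x t * pdt sol.u x t)
      + (pdx sol.ρ x t * (sol.u x t * sol.u x t)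
          + sol.ρ x t * (pdx sol.u x t * sol.u x t + sol.u x t * pdx sol.u x t)
        + (pdx sol.ρ x t * sol.θ x t + sol.ρ x t * pdx sol.θ x t)
        + (sol.b 0 x t * pdx (sol.b 0) x t + sol.b 1 x t * pdx (sol.b 1) x t))
      = pdx (pdx sol.u) x t := by
  have h := sol.eq_mom x hx t ht
  have hρ : Sm sol.ρ := sol.smooth_ρ
  have hu : Sm sol.u := sol.smooth_u
  have hθ : Sm sol.θ := sol.smooth_θ
  have hb : ∀ i, Sm (sol.b i) := sol.smooth_b
  have e1 : pdt (fun x t => sol.ρ x t * sol.u x t) x t = _ :=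
    ((hρ.hasT x t).fun_mul (hu.hasT x t)).deriv
  simp only [Fin.sum_univ_two, pow_two] at h
  have e2 : pdx (fun x t => sol.ρ x t * (sol.u x t * sol.u x t) + sol.ρ x t * sol.θ x t
      + (sol.b 0 x t * sol.b 0 x t + sol.b 1 x t * sol.b 1 x t) / 2) x t = _ :=
    ((((hρ.hasX x t).fun_mul ((hu.hasX x t).fun_mul (hu.hasX x t))).fun_add
      ((hρ.hasX x t).fun_mul (hθ.hasX x t))).fun_add
      ((((hb 0).hasX x t).fun_mul ((hb 0).hasX x t)).fun_add
      (((hb 1).hasX x t).fun_mul ((hb 1).hasX x t)) |>.div_const 2)).deriv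
  rw [e1, e2] at h
  linear_combination h

lemma pt_w (sol : MHDSol T κ) (i : Fin 2) {x t : ℝ} (hx : x ∈ Icc (0:ℝ) 1)
    (ht : t ∈ Icc (0:ℝ) T) :
    (pdt sol.ρ x t * sol.w i x t + sol.ρ x t * pdt (sol.w i) x t)
      + ((pdx sol.ρ x t * sol.u x t + sol.ρ x t * pdx sol.u x t) * sol.w i x t
        + sol.ρ x t * sol.u x t * pdx (sol.w i) x t - pdx (sol.b i) x t)
      = pdx (pdx (sol.w i)) x t := by
  have h := sol.eq_w i x hx t ht
  have hρ : Sm sol.ρ := sol.smooth_ρ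
  have hu : Sm sol.u := sol.smooth_u
  have hb : Sm (sol.b i) := sol.smooth_b i
  have hw : Sm (sol.w i) := sol.smooth_w i
  have e1 : pdt (fun x t => sol.ρ x t * sol.w i x t) x t = _ :=
    ((hρ.hasT x t).fun_mul (hw.hasT x t)).deriv
  have e2 : pdx (fun x t => sol.ρ x t * sol.u x t * sol.w i x t - sol.b i x t) x t = _ :=
    ((((hρ.hasX x t).fun_mul (hu.hasX x t)).fun_mul (hw.hasX x t)).fun_sub (hb.hasX x t)).deriv
  rw [e1, e2] at h
  linear_combination h

lemma pt_b (sol : MHDSol T κ) (i : Fin 2) {x t : ℝ} (hx : x ∈ Icc (0:ℝ) 1)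
    (ht : t ∈ Icc (0:ℝ) T) :
    pdt (sol.b i) x t + (pdx sol.u x t * sol.b i x t + sol.u x t * pdx (sol.b i) x t
        - pdx (sol.w i) x t)
      = pdx (pdx (sol.b i)) x t := by
  have h := sol.eq_b i x hx t ht
  have hu : Sm sol.u := sol.smooth_u
  have hb : Sm (sol.b i) := sol.smooth_b i
  have hw : Sm (sol.w i) := sol.smooth_w i
  have e2 : pdx (fun x t => sol.u x t * sol.b i x t - sol.w i x t) x t = _ :=
    (((hu.hasX x t).fun_mul (hb.hasX x t)).fun_sub (hw.hasX x t)).deriv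
  rw [e2] at h
  linear_combination h

/-- Heat flux. -/
def flux (sol : MHDSol T κ) : ℝ → ℝ → ℝ := fun x t => κ (sol.θ x t) * pdx sol.θ x t

/-- Dissipation. -/
def diss (sol : MHDSol T κ) : ℝ → ℝ → ℝ := fun x t =>
  (pdx sol.u x t) ^ 2 + ((pdx (sol.w 0) x t) ^ 2 + (pdx (sol.w 1) x t) ^ 2)
    + ((pdx (sol.b 0) x t) ^ 2 + (pdx (sol.b 1) x t) ^ 2)

lemma pt_θ (sol : MHDSol T κ) {x t : ℝ} (hx : x ∈ Icc (0:ℝ) 1) (ht : t ∈ Icc (0:ℝ) T) :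
    (pdt sol.ρ x t * sol.θ x t + sol.ρ x t * pdt sol.θ x t)
      + ((pdx sol.ρ x t * sol.u x t + sol.ρ x t * pdx sol.u x t) * sol.θ x t
        + sol.ρ x t * sol.u x t * pdx sol.θ x t) - pdx (flux sol) x t
      = diss sol x t - sol.ρ x t * sol.θ x t * pdx sol.u x t := by
  have h := sol.eq_θ x hx t ht
  have hρ : Sm sol.ρ := sol.smooth_ρ
  have hu : Sm sol.u := sol.smooth_u
  have hθ : Sm sol.θ := sol.smooth_θ
  have e1 : pdt (fun x t => sol.ρ x t * sol.θ x t) x t = _ :=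
    ((hρ.hasT x t).fun_mul (hθ.hasT x t)).deriv
  have e2 : pdx (fun x t => sol.ρ x t * sol.u x t * sol.θ x t) x t = _ :=
    (((hρ.hasX x t).fun_mul (hu.hasX x t)).fun_mul (hθ.hasX x t)).deriv
  simp only [Fin.sum_univ_two] at h
  rw [e1, e2] at h
  unfold flux diss
  linear_combination h

lemma flux_hasX {q C₀ : ℝ} (hκ : KappaHyp q C₀ κ) (sol : MHDSol T κ) {x t : ℝ}
    (hx : x ∈ Icc (0:ℝ) 1) (ht : t ∈ Icc (0:ℝ) T) :
    HasDerivAt (fun y => flux sol y t) (pdx (flux sol) x t) x := by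
  have hθ : Sm sol.θ := sol.smooth_θ
  have hp := sol.θ_pos x hx t ht
  have hk : DifferentiableAt ℝ κ (sol.θ x t) :=
    (hκ.1.contDiffAt (Ici_mem_nhds hp)).differentiableAt (by simp)
  have h1 : DifferentiableAt ℝ (fun y => κ (sol.θ y t)) x :=
    DifferentiableAt.comp x (g := κ) hk (hθ.hasX x t).differentiableAt
  have h2 : DifferentiableAt ℝ (fun y => flux sol y t) x :=
    h1.mul (hθ.dx.hasX x t).differentiableAt
  exact h2.hasDerivAt

/-- Total energy density. -/
def energy (sol : MHDSol T κ) : ℝ → ℝ → ℝ := fun x t =>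
  sol.ρ x t * (sol.u x t * sol.u x t + (sol.w 0 x t * sol.w 0 x t + sol.w 1 x t * sol.w 1 x t)) / 2
    + sol.ρ x t * sol.θ x t + (sol.b 0 x t * sol.b 0 x t + sol.b 1 x t * sol.b 1 x t) / 2

lemma energy_sm (sol : MHDSol T κ) : Sm (energy sol) := by
  have hρ : ContDiff ℝ (⊤ : ℕ∞) (fun p : ℝ × ℝ => sol.ρ p.1 p.2) := sol.smooth_ρ
  have hu : ContDiff ℝ (⊤ : ℕ∞) (fun p : ℝ × ℝ => sol.u p.1 p.2) := sol.smooth_u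
  have hθ : ContDiff ℝ (⊤ : ℕ∞) (fun p : ℝ × ℝ => sol.θ p.1 p.2) := sol.smooth_θ
  have hw : ∀ i, ContDiff ℝ (⊤ : ℕ∞) (fun p : ℝ × ℝ => sol.w i p.1 p.2) := sol.smooth_w
  have hb : ∀ i, ContDiff ℝ (⊤ : ℕ∞) (fun p : ℝ × ℝ => sol.b i p.1 p.2) := sol.smooth_b
  show ContDiff ℝ (⊤ : ℕ∞) (fun p : ℝ × ℝ => energy sol p.1 p.2)
  unfold energy
  have hw0 := hw 0
  have hw1 := hw 1
  have hb0 := hb 0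
  have hb1 := hb 1
  exact (((hρ.mul ((hu.mul hu).add ((hw0.mul hw0).add (hw1.mul hw1)))).div_const 2).add
    (hρ.mul hθ)).add (((hb0.mul hb0).add (hb1.mul hb1)).div_const 2)

lemma mass_cons (sol : MHDSol T κ) {t : ℝ} (ht : t ∈ Icc (0:ℝ) T) :
    (∫ x in (0:ℝ)..1, sol.ρ x t) = ∫ x in (0:ℝ)..1, sol.ρ x 0 := by
  have hρ : Sm sol.ρ := sol.smooth_ρ
  have hu : Sm sol.u := sol.smooth_u
  have hs : ∀ s ∈ Icc (0:ℝ) t, s ∈ Icc (0:ℝ) T := fun s hs => ⟨hs.1, hs.2.trans ht.2⟩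
  have := balance ht.1 sol.ρ (pdt sol.ρ) (fun x t => sol.ρ x t * sol.u x t) (fun _ _ => 0)
    (fun x _ t _ => hρ.hasT x t)
    (fun x hx t ht => by
      refine ((hρ.hasX x t).fun_mul (hu.hasX x t)).congr_deriv ?_
      linear_combination pt_mass sol hx (hs t ht))
    hρ.cont.continuousOn hρ.dt.cont.continuousOn continuousOn_const
    (fun t ht => by simp [(sol.bc_u t (hs t ht)).1])
    (fun t ht => by simp [(sol.bc_u t (hs t ht)).2])
  simpa using this

lemma energy_cons {q C₀ : ℝ} (hκ : KappaHyp q C₀ κ) (sol : MHDSol T κ) {t : ℝ}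
    (ht : t ∈ Icc (0:ℝ) T) :
    (∫ x in (0:ℝ)..1, energy sol x t) = ∫ x in (0:ℝ)..1, energy sol x 0 := by
  have hρ : Sm sol.ρ := sol.smooth_ρ
  have hu : Sm sol.u := sol.smooth_u
  have hθ : Sm sol.θ := sol.smooth_θ
  have hw : ∀ i, Sm (sol.w i) := sol.smooth_w
  have hb : ∀ i, Sm (sol.b i) := sol.smooth_b
  have hs : ∀ s ∈ Icc (0:ℝ) t, s ∈ Icc (0:ℝ) T := fun s hs => ⟨hs.1, hs.2.trans ht.2⟩
  have he := energy_sm sol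
  have := balance ht.1 (energy sol) (pdt (energy sol))
    (fun x t => sol.ρ x t * sol.u x t * (sol.u x t * sol.u x t
          + (sol.w 0 x t * sol.w 0 x t + sol.w 1 x t * sol.w 1 x t)) / 2
        + sol.u x t * (2 * (sol.ρ x t * sol.θ x t)
          + (sol.b 0 x t * sol.b 0 x t + sol.b 1 x t * sol.b 1 x t))
        - flux sol x t - (sol.w 0 x t * sol.b 0 x t + sol.w 1 x t * sol.b 1 x t)
        - sol.u x t * pdx sol.u x t
        - (sol.w 0 x t * pdx (sol.w 0) x t + sol.w 1 x t * pdx (sol.w 1) x t)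
        - (sol.b 0 x t * pdx (sol.b 0) x t + sol.b 1 x t * pdx (sol.b 1) x t))
    (fun _ _ => 0)
    (fun x _ t _ => he.hasT x t)
    (fun x hx t ht => by
      have et : pdt (energy sol) x t = _ :=
        (((((hρ.hasT x t).fun_mul (((hu.hasT x t).fun_mul (hu.hasT x t)).fun_add
          ((((hw 0).hasT x t).fun_mul ((hw 0).hasT x t)).fun_add
          (((hw 1).hasT x t).fun_mul ((hw 1).hasT x t))))).div_const 2).fun_add
          ((hρ.hasT x t).fun_mul (hθ.hasT x t))).fun_add
          (((((hb 0).hasT x t).fun_mul ((hb 0).hasT x t)).fun_add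
          (((hb 1).hasT x t).fun_mul ((hb 1).hasT x t))).div_const 2)).deriv
      have R := hρ.hasX x t
      have U := hu.hasX x t
      have H := hθ.hasX x t
      have W0 := (hw 0).hasX x t
      have W1 := (hw 1).hasX x t
      have B0 := (hb 0).hasX x t
      have B1 := (hb 1).hasX x t
      have UX := hu.dx.hasX x t
      have WX0 := (hw 0).dx.hasX x t
      have WX1 := (hw 1).dx.hasX x t
      have BX0 := (hb 0).dx.hasX x t
      have BX1 := (hb 1).dx.hasX x t
      have Z := flux_hasX hκ sol hx (hs t ht)
      refine ((((((((R.fun_mul U).fun_mul ((U.fun_mul U).fun_add ((W0.fun_mul W0).fun_add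
        (W1.fun_mul W1)))).div_const 2).fun_add (U.fun_mul (((R.fun_mul H).const_mul 2).fun_add
        ((B0.fun_mul B0).fun_add (B1.fun_mul B1))))).fun_sub Z).fun_sub
        ((W0.fun_mul B0).fun_add (W1.fun_mul B1))).fun_sub (U.fun_mul UX)).fun_sub
        ((W0.fun_mul WX0).fun_add (W1.fun_mul WX1))).fun_sub
        ((B0.fun_mul BX0).fun_add (B1.fun_mul BX1)) |>.congr_deriv ?_
      rw [et]
      have h1 := pt_mass sol hx (hs t ht)
      have h2 := pt_mom sol hx (hs t ht)
      have h3 := pt_w sol 0 hx (hs t ht)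
      have h4 := pt_w sol 1 hx (hs t ht)
      have h5 := pt_b sol 0 hx (hs t ht)
      have h6 := pt_b sol 1 hx (hs t ht)
      have h7 := pt_θ sol hx (hs t ht)
      unfold diss at h7
      linear_combination sol.u x t * h2 + sol.w 0 x t * h3 + sol.w 1 x t * h4
        + sol.b 0 x t * h5 + sol.b 1 x t * h6 + h7
        - (sol.u x t ^ 2 + sol.w 0 x t ^ 2 + sol.w 1 x t ^ 2) / 2 * h1)
    he.cont.continuousOn he.dt.cont.continuousOn continuousOn_const
    (fun t ht => by
      simp [flux, (sol.bc_u t (hs t ht)).1, (sol.bc_w 0 t (hs t ht)).1, (sol.bc_w 1 t (hs t ht)).1,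
        (sol.bc_b 0 t (hs t ht)).1, (sol.bc_b 1 t (hs t ht)).1, (sol.bc_θ t (hs t ht)).1])
    (fun t ht => by
      simp [flux, (sol.bc_u t (hs t ht)).2, (sol.bc_w 0 t (hs t ht)).2, (sol.bc_w 1 t (hs t ht)).2,
        (sol.bc_b 0 t (hs t ht)).2, (sol.bc_b 1 t (hs t ht)).2, (sol.bc_θ t (hs t ht)).2])
  simpa using this

end fields

lemma leibniz {G : ℝ → ℝ → ℝ} (hG : Sm G) (x t : ℝ) :
    HasDerivAt (fun y => ∫ s in (0:ℝ)..t, G y s) (∫ s in (0:ℝ)..t, pdx G x s) x := by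
  have hc : ContinuousOn (fun p : ℝ × ℝ => pdx G p.1 p.2)
    (Metric.closedBall x 1 ×ˢ uIcc 0 t) := hG.dx.cont.continuousOn
  obtain ⟨C, hC⟩ := ((isCompact_closedBall x 1).prod isCompact_uIcc).exists_bound_of_continuousOn hc
  refine (intervalIntegral.hasDerivAt_integral_of_dominated_loc_of_deriv_le
    (F := G) (F' := pdx G) (x₀ := x) (s := Metric.closedBall x 1) (bound := fun _ => C)
    (Metric.closedBall_mem_nhds x one_pos) ?_ ?_ ?_ ?_ ?_ ?_).2
  · exact Filter.Eventually.of_forall (fun y =>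
      (hG.cont2 continuous_const continuous_id).aestronglyMeasurable)
  · exact (hG.cont2 continuous_const continuous_id).intervalIntegrable _ _
  · exact (hG.dx.cont2 continuous_const continuous_id).aestronglyMeasurable
  · exact Filter.Eventually.of_forall (fun s hs y hy => hC (y, s) ⟨hy, uIoc_subset_uIcc hs⟩)
  · exact continuous_const.intervalIntegrable _ _
  · exact Filter.Eventually.of_forall (fun s _ y _ => hG.hasX y s)

/-- Weak maximum principle for transport. -/
lemma max_principle {T : ℝ} {F Ft Fx u : ℝ → ℝ → ℝ} {L : ℝ}
    (cF : ContinuousOn (fun p : ℝ × ℝ => F p.1 p.2) (Icc (0:ℝ) 1 ×ˢ Icc (0:ℝ) T))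
    (ht : ∀ x ∈ Icc (0:ℝ) 1, ∀ t ∈ Icc (0:ℝ) T, HasDerivAt (fun s => F x s) (Ft x t) t)
    (hx : ∀ x ∈ Icc (0:ℝ) 1, ∀ t ∈ Icc (0:ℝ) T, HasDerivAt (fun y => F y t) (Fx x t) x)
    (hle : ∀ x ∈ Icc (0:ℝ) 1, ∀ t ∈ Icc (0:ℝ) T, Ft x t + u x t * Fx x t ≤ 0)
    (h0 : ∀ t ∈ Icc (0:ℝ) T, u 0 t = 0) (h1 : ∀ t ∈ Icc (0:ℝ) T, u 1 t = 0)
    (hL : ∀ x ∈ Icc (0:ℝ) 1, F x 0 ≤ L) {x t : ℝ} (hxI : x ∈ Icc (0:ℝ) 1)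
    (htI : t ∈ Icc (0:ℝ) T) : F x t ≤ L := by
  have hT : 0 ≤ T := htI.1.trans htI.2
  have key : ∀ ε : ℝ, 0 < ε → F x t ≤ L + ε * t := by
    intro ε hε
    have cG : ContinuousOn (fun p : ℝ × ℝ => F p.1 p.2 - ε * p.2)
        (Icc (0:ℝ) 1 ×ˢ Icc (0:ℝ) T) := cF.sub (by fun_prop)
    obtain ⟨⟨y, s⟩, ⟨hy, hs⟩, hmax⟩ := (isCompact_Icc.prod isCompact_Icc).exists_isMaxOn
      ⟨(x, t), hxI, htI⟩ cG
    simp only at hy hs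
    have hm : ∀ y' ∈ Icc (0:ℝ) 1, ∀ s' ∈ Icc (0:ℝ) T, F y' s' - ε * s' ≤ F y s - ε * s :=
      fun y' hy' s' hs' => hmax (show (y', s') ∈ _ from ⟨hy', hs'⟩)
    rcases hs.1.eq_or_lt with h | h
    · have := hm x hxI t htI
      subst h
      have := hL y hy
      linarith
    · exfalso
      have hux : u y s * Fx y s = 0 := by
        rcases hy.1.eq_or_lt with h' | h'
        · rw [← h', h0 s hs, zero_mul]
        · rcases hy.2.eq_or_lt with h'' | h''
          · rw [h'', h1 s hs, zero_mul]
          · have : IsLocalMax (fun z => F z s) y := by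
              filter_upwards [Icc_mem_nhds h' h''] with z hz
              have := hm z hz s hs
              linarith
            rw [this.hasDerivAt_eq_zero (hx y hy s hs), mul_zero]
      have hFt : ε ≤ Ft y s := by
        have hd := (ht y hy s hs).hasDerivWithinAt (s := Iio s)
        rw [hasDerivWithinAt_iff_tendsto_slope' (by simp)] at hd
        refine ge_of_tendsto hd ?_
        filter_upwards [Ioo_mem_nhdsLT h] with r hr
        have := hm y hy r ⟨hr.1.le, hr.2.le.trans hs.2⟩
        rw [slope_def_field, le_div_iff_of_neg (by linarith [hr.2])]
        linarith
      have := hle y hy s hs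
      linarith
  by_contra hcon
  push Not at hcon
  have h := key ((F x t - L) / (2 * (T + 1))) (by apply div_pos <;> linarith)
  have h2 : (F x t - L) / (2 * (T + 1)) * t ≤ (F x t - L) / 2 := by
    rw [div_mul_eq_mul_div, div_le_div_iff₀ (by linarith) (by norm_num)]
    nlinarith [htI.2]
  linarith

section fields

variable {T : ℝ} {κ : ℝ → ℝ}

/-- Momentum flux without viscosity. -/
def nn (sol : MHDSol T κ) : ℝ → ℝ → ℝ := fun x t =>
  sol.ρ x t * (sol.u x t * sol.u x t) + sol.ρ x t * sol.θ x t
    + (sol.b 0 x t * sol.b 0 x t + sol.b 1 x t * sol.b 1 x t) / 2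

def gg (sol : MHDSol T κ) : ℝ → ℝ → ℝ := fun x t => pdx sol.u x t - nn sol x t

def psi (sol : MHDSol T κ) : ℝ → ℝ → ℝ := fun x t =>
  (∫ s in (0:ℝ)..t, gg sol x s) + ∫ y in (0:ℝ)..x, sol.ρ y 0 * sol.u y 0

lemma nn_sm (sol : MHDSol T κ) : Sm (nn sol) := by
  have hρ : ContDiff ℝ (⊤ : ℕ∞) (fun p : ℝ × ℝ => sol.ρ p.1 p.2) := sol.smooth_ρ
  have hu : ContDiff ℝ (⊤ : ℕ∞) (fun p : ℝ × ℝ => sol.u p.1 p.2) := sol.smooth_u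
  have hθ : ContDiff ℝ (⊤ : ℕ∞) (fun p : ℝ × ℝ => sol.θ p.1 p.2) := sol.smooth_θ
  have hb : ∀ i, ContDiff ℝ (⊤ : ℕ∞) (fun p : ℝ × ℝ => sol.b i p.1 p.2) := sol.smooth_b
  have hb0 := hb 0
  have hb1 := hb 1
  exact ((hρ.mul (hu.mul hu)).add (hρ.mul hθ)).add
    (((hb0.mul hb0).add (hb1.mul hb1)).div_const 2)

lemma gg_sm (sol : MHDSol T κ) : Sm (gg sol) := by
  have hu : Sm sol.u := sol.smooth_u
  exact ContDiff.sub hu.dx (nn_sm sol)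

lemma psi_hasT (sol : MHDSol T κ) (x t : ℝ) :
    HasDerivAt (fun s => psi sol x s) (gg sol x t) t := by
  have hc : Continuous (fun s => gg sol x s) := (gg_sm sol).cont2 continuous_const continuous_id
  exact (hc.integral_hasStrictDerivAt 0 t).hasDerivAt.add_const _

lemma psi_hasX (sol : MHDSol T κ) {x t : ℝ} (hx : x ∈ Icc (0:ℝ) 1) (ht : t ∈ Icc (0:ℝ) T) :
    HasDerivAt (fun y => psi sol y t) (sol.ρ x t * sol.u x t) x := by
  have hρ : Sm sol.ρ := sol.smooth_ρ
  have hu : Sm sol.u := sol.smooth_u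
  have hθ : Sm sol.θ := sol.smooth_θ
  have hb : ∀ i, Sm (sol.b i) := sol.smooth_b
  have hc : Continuous (fun y => sol.ρ y 0 * sol.u y 0) :=
    (hρ.cont2 continuous_id continuous_const).mul (hu.cont2 continuous_id continuous_const)
  refine ((leibniz (gg_sm sol) x t).add (hc.integral_hasStrictDerivAt 0 x).hasDerivAt).congr_deriv ?_
  have hs : ∀ s ∈ Icc (0:ℝ) t, s ∈ Icc (0:ℝ) T := fun s hs => ⟨hs.1, hs.2.trans ht.2⟩
  have e := ftc (f := fun s => sol.ρ x s * sol.u x s) (f' := fun s => pdx (gg sol) x s) ht.1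
    (fun s hs' => by
      refine ((hρ.hasT x s).fun_mul (hu.hasT x s)).congr_deriv ?_
      have R := hρ.hasX x s
      have U := hu.hasX x s
      have e2 : pdx (gg sol) x s = _ := ((hu.dx.hasX x s).fun_sub
        (((R.fun_mul (U.fun_mul U)).fun_add (R.fun_mul (hθ.hasX x s))).fun_add
        ((((hb 0).hasX x s).fun_mul ((hb 0).hasX x s)).fun_add
        (((hb 1).hasX x s).fun_mul ((hb 1).hasX x s)) |>.div_const 2))).deriv
      rw [e2]
      linear_combination pt_mom sol hx (hs s hs'))
    ((gg_sm sol).dx.cont2 continuous_const continuous_id).continuousOn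
  rw [e]
  ring

lemma psi_cont (sol : MHDSol T κ) : Continuous (fun p : ℝ × ℝ => psi sol p.1 p.2) := by
  have hρ : Sm sol.ρ := sol.smooth_ρ
  have hu : Sm sol.u := sol.smooth_u
  have h1 : Continuous (fun p : ℝ × ℝ => ∫ s in (0:ℝ)..p.2, gg sol p.1 s) := by
    apply intervalIntegral.continuous_parametric_intervalIntegral_of_continuous _ continuous_snd
    exact (gg_sm sol).cont2 (by fun_prop) (by fun_prop)
  have hc : Continuous (fun y => sol.ρ y 0 * sol.u y 0) :=
    (hρ.cont2 continuous_id continuous_const).mul (hu.cont2 continuous_id continuous_const)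
  have h2 : Continuous (fun x : ℝ => ∫ y in (0:ℝ)..x, sol.ρ y 0 * sol.u y 0) :=
    intervalIntegral.continuous_primitive (fun a b => hc.intervalIntegrable a b) 0
  exact h1.add (h2.comp continuous_fst)

/-- Consequences of the initial bounds. -/
lemma init_pt {A B M : ℝ} (sol : MHDSol T κ) (h : InitBounds sol A B M) {x : ℝ}
    (hx : x ∈ Icc (0:ℝ) 1) :
    (sol.ρ x 0) ^ 2 ≤ 2 * A ^ 2 ∧ (sol.u x 0) ^ 2 ≤ 2 * A ^ 2 ∧ (sol.θ x 0) ^ 2 ≤ 2 * A ^ 2 ∧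
    (∀ i, (sol.w i x 0) ^ 2 ≤ 2 * A ^ 2) ∧ (∀ i, (sol.b i x 0) ^ 2 ≤ 2 * A ^ 2) := by
  have sl : ∀ f : ℝ → ℝ → ℝ, Sm f → ContDiff ℝ (⊤ : ℕ∞) (fun x => f x 0) := by
    intro f hf
    have : (fun x => f x 0) = Function.uncurry f ∘ (fun y => (y, (0:ℝ))) := rfl
    rw [this]
    exact ContDiff.comp hf (by fun_prop)
  obtain ⟨h1, h2, h3, h4, h5, -⟩ := h
  exact ⟨sup_of_H2 (sl _ sol.smooth_ρ) h1 hx, sup_of_H2 (sl _ sol.smooth_u) h2 hx,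
    sup_of_H2 (sl _ sol.smooth_θ) h3 hx, fun i => sup_of_H2 (sl _ (sol.smooth_w i)) (h4 i) hx,
    fun i => sup_of_H2 (sl _ (sol.smooth_b i)) (h5 i) hx⟩

lemma le_one_add_sq {a A : ℝ} (h : a ^ 2 ≤ 2 * A ^ 2) : |a| ≤ 1 + 2 * A ^ 2 := by
  nlinarith [sq_nonneg (|a| - 1), sq_abs a]

lemma integral_le_const {f : ℝ → ℝ} {c : ℝ} (cf : ContinuousOn f (Icc (0:ℝ) 1))
    (h : ∀ x ∈ Icc (0:ℝ) 1, f x ≤ c) : ∫ x in (0:ℝ)..1, f x ≤ c := by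
  have := intervalIntegral.integral_mono_on zero_le_one (ii01 zero_le_one cf)
    (continuous_const.intervalIntegrable (μ := volume) 0 1) h
  simpa using this

lemma energy_le {q C₀ A B M : ℝ} (hT : 0 < T) (hκ : KappaHyp q C₀ κ) (sol : MHDSol T κ)
    (h : InitBounds sol A B M) {t : ℝ} (ht : t ∈ Icc (0:ℝ) T) :
    ∫ x in (0:ℝ)..1, energy sol x t ≤ 4 * (1 + 2 * A ^ 2) ^ 2 := by
  rw [energy_cons hκ sol ht]
  apply integral_le_const
  · exact ((energy_sm sol).cont2 continuous_id continuous_const).continuousOn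
  intro x hx
  obtain ⟨h1, h2, h3, h4, h5⟩ := init_pt sol h hx
  have p1 := sol.ρ_pos x hx 0 ⟨le_rfl, hT.le⟩
  have p3 := sol.θ_pos x hx 0 ⟨le_rfl, hT.le⟩
  have q1 := (le_abs_self _).trans (le_one_add_sq h1)
  have q3 := (le_abs_self _).trans (le_one_add_sq h3)
  have w0 := h4 0
  have w1 := h4 1
  have b0 := h5 0
  have b1 := h5 1
  unfold energy
  set K := 1 + 2 * A ^ 2 with hK
  have hK1 : 1 ≤ K := by nlinarith [sq_nonneg A]
  have m1 : sol.ρ x 0 * sol.θ x 0 ≤ K * K := mul_le_mul q1 q3 p3.le (by linarith)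
  have m2 : sol.ρ x 0 * (sol.u x 0 * sol.u x 0
      + (sol.w 0 x 0 * sol.w 0 x 0 + sol.w 1 x 0 * sol.w 1 x 0)) ≤ K * (3 * K) := by
    apply mul_le_mul q1 _ _ (by linarith)
    · nlinarith
    · nlinarith [sq_nonneg (sol.u x 0), sq_nonneg (sol.w 0 x 0), sq_nonneg (sol.w 1 x 0)]
  nlinarith

lemma mass_le {A B M : ℝ} (sol : MHDSol T κ) (h : InitBounds sol A B M) {t : ℝ}
    (ht : t ∈ Icc (0:ℝ) T) : ∫ x in (0:ℝ)..1, sol.ρ x t ≤ 1 + 2 * A ^ 2 := by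
  rw [mass_cons sol ht]
  have hρ : Sm sol.ρ := sol.smooth_ρ
  apply integral_le_const
  · exact (hρ.cont2 continuous_id continuous_const).continuousOn
  intro x hx
  exact (le_abs_self _).trans (le_one_add_sq (init_pt sol h hx).1)

lemma psi_zero_le {A B M : ℝ} (sol : MHDSol T κ) (h : InitBounds sol A B M) {x : ℝ}
    (hx : x ∈ Icc (0:ℝ) 1) : |psi sol x 0| ≤ (1 + 2 * A ^ 2) ^ 2 := by
  unfold psi
  rw [intervalIntegral.integral_same, zero_add]
  have := intervalIntegral.norm_integral_le_of_norm_le_const (a := 0) (b := x)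
    (f := fun y => sol.ρ y 0 * sol.u y 0) (C := (1 + 2 * A ^ 2) ^ 2) (fun y hy => by
      rw [uIoc_of_le hx.1] at hy
      obtain ⟨h1, h2, -⟩ := init_pt sol h (x := y) ⟨hy.1.le, hy.2.trans hx.2⟩
      rw [norm_mul, pow_two]
      exact mul_le_mul (le_one_add_sq h1) (le_one_add_sq h2) (norm_nonneg _) (by positivity))
  rw [Real.norm_eq_abs] at this
  refine this.trans ?_
  rw [sub_zero, abs_of_nonneg hx.1]
  exact mul_le_of_le_one_right (by positivity) hx.2

lemma psi_lower {q C₀ A B M : ℝ} (hT : 0 < T) (hκ : KappaHyp q C₀ κ) (sol : MHDSol T κ)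
    (h : InitBounds sol A B M) {x t : ℝ} (hx : x ∈ Icc (0:ℝ) 1) (ht : t ∈ Icc (0:ℝ) T) :
    -((1 + 2 * A ^ 2) ^ 2 + T * (8 * (1 + 2 * A ^ 2) ^ 2)
      + ((1 + 2 * A ^ 2) + 4 * (1 + 2 * A ^ 2) ^ 2)) ≤ psi sol x t := by
  have hρ : Sm sol.ρ := sol.smooth_ρ
  have hu : Sm sol.u := sol.smooth_u
  have hs : ∀ s ∈ Icc (0:ℝ) t, s ∈ Icc (0:ℝ) T := fun s hs => ⟨hs.1, hs.2.trans ht.2⟩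
  set K := 1 + 2 * A ^ 2 with hK
  have bal := balance ht.1 (psi sol) (gg sol) (fun x t => - sol.u x t)
    (fun x t => - nn sol x t) (fun x _ t _ => psi_hasT sol x t)
    (fun x hx t ht => (hu.hasX x t).fun_neg.congr_deriv (by unfold gg; ring))
    (psi_cont sol).continuousOn (gg_sm sol).cont.continuousOn (nn_sm sol).cont.neg.continuousOn
    (fun t ht => by simp [(sol.bc_u t (hs t ht)).1])
    (fun t ht => by simp [(sol.bc_u t (hs t ht)).2])
  have cψ : ∀ t, Continuous (fun x => psi sol x t) := fun t =>
    (psi_cont sol).comp (f := fun x : ℝ => (x, t)) (by fun_prop)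
  have ce : ∀ t, Continuous (fun x => energy sol x t) := fun t =>
    (energy_sm sol).cont2 continuous_id continuous_const
  have cn : ∀ t, Continuous (fun x => nn sol x t) := fun t =>
    (nn_sm sol).cont2 continuous_id continuous_const
  have cρ : ∀ t, Continuous (fun x => sol.ρ x t) := fun t =>
    hρ.cont2 continuous_id continuous_const
  have cu : ∀ t, Continuous (fun x => sol.u x t) := fun t =>
    hu.cont2 continuous_id continuous_const
  have i0 : ∫ x in (0:ℝ)..1, - psi sol x 0 ≤ K ^ 2 :=
    integral_le_const (cψ 0).neg.continuousOn (fun x hx => by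
      have := (abs_le.1 (psi_zero_le sol h hx)).1
      linarith)
  rw [intervalIntegral.integral_neg] at i0
  have in1 : ∀ s ∈ Icc (0:ℝ) t, -(8 * K ^ 2) ≤ ∫ x in (0:ℝ)..1, - nn sol x s := by
    intro s hs'
    have e1 : ∫ x in (0:ℝ)..1, nn sol x s ≤ ∫ x in (0:ℝ)..1, 2 * energy sol x s := by
      apply intervalIntegral.integral_mono_on zero_le_one ((cn s).intervalIntegrable _ _)
        (((ce s).const_mul 2).intervalIntegrable _ _)
      intro x hx
      have p1 := sol.ρ_pos x hx s (hs s hs')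
      have p3 := sol.θ_pos x hx s (hs s hs')
      have p2 := mul_pos p1 p3
      unfold nn energy
      have a1 := mul_nonneg p1.le (mul_self_nonneg (sol.w 0 x s))
      have a2 := mul_nonneg p1.le (mul_self_nonneg (sol.w 1 x s))
      nlinarith [mul_self_nonneg (sol.b 0 x s), mul_self_nonneg (sol.b 1 x s)]
    rw [intervalIntegral.integral_const_mul] at e1
    have := energy_le hT hκ sol h (hs s hs')
    rw [intervalIntegral.integral_neg]
    linarith
  have in2 : -(T * (8 * K ^ 2)) ≤ ∫ s in (0:ℝ)..t, ∫ x in (0:ℝ)..1, - nn sol x s := by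
    have := intervalIntegral.integral_mono_on ht.1
      (continuous_const.intervalIntegrable (μ := volume) 0 t)
      (ii_param (f := fun x s => - nn sol x s) ht.1 (nn_sm sol).cont.neg.continuousOn) in1
    rw [intervalIntegral.integral_const, smul_eq_mul] at this
    nlinarith [ht.2, sq_nonneg K]
  obtain ⟨y, hy, hyle⟩ := exists_le_avg (r := fun _ => 1) (f := fun x => - psi sol x t)
    (by fun_prop) (cψ t).neg.continuousOn (fun _ _ => zero_le_one)
  simp only [one_mul, intervalIntegral.integral_neg, intervalIntegral.integral_const, sub_zero,
    smul_eq_mul, mul_one] at hyle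
  have os := osc (f := fun x => psi sol x t) (f' := fun x => sol.ρ x t * sol.u x t)
    (g := fun x => sol.ρ x t + energy sol x t) (fun z hz => psi_hasX sol hz ht)
    ((cρ t).mul (cu t)).continuousOn ((cρ t).add (ce t)).continuousOn
    (fun z hz => by
      have p1 := sol.ρ_pos z hz t ht
      have p3 := sol.θ_pos z hz t ht
      have p2 := mul_pos p1 p3
      rw [abs_mul, abs_of_pos p1]
      unfold energy
      have a1 := mul_nonneg p1.le (mul_self_nonneg (sol.w 0 z t))
      have a2 := mul_nonneg p1.le (mul_self_nonneg (sol.w 1 z t))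
      have a3 := mul_nonneg p1.le (mul_self_nonneg (|sol.u z t| - 1))
      have a4 := abs_mul_abs_self (sol.u z t)
      have a5 : sol.ρ z t * (|sol.u z t| * |sol.u z t|) = sol.ρ z t * (sol.u z t * sol.u z t) := by
        rw [a4]
      nlinarith [mul_self_nonneg (sol.b 0 z t), mul_self_nonneg (sol.b 1 z t)])
    hy hx
  rw [intervalIntegral.integral_add ((cρ t).intervalIntegrable _ _)
    ((ce t).intervalIntegrable _ _)] at os
  have e1 := energy_le hT hκ sol h ht
  have e2 := mass_le sol h ht
  linarith

/-- The constant bounding the density. -/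
def RR (T A : ℝ) : ℝ := (1 + 2 * A ^ 2) * Real.exp ((1 + 2 * A ^ 2) ^ 2) *
  Real.exp ((1 + 2 * A ^ 2) ^ 2 + T * (8 * (1 + 2 * A ^ 2) ^ 2)
      + ((1 + 2 * A ^ 2) + 4 * (1 + 2 * A ^ 2) ^ 2))

lemma rho_le {q C₀ A B M : ℝ} (hT : 0 < T) (hκ : KappaHyp q C₀ κ) (sol : MHDSol T κ)
    (h : InitBounds sol A B M) {x t : ℝ} (hx : x ∈ Icc (0:ℝ) 1) (ht : t ∈ Icc (0:ℝ) T) :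
    sol.ρ x t ≤ RR T A := by
  have hρ : Sm sol.ρ := sol.smooth_ρ
  have key : sol.ρ x t * Real.exp (psi sol x t)
      ≤ (1 + 2 * A ^ 2) * Real.exp ((1 + 2 * A ^ 2) ^ 2) := by
    refine max_principle (T := T) (F := fun x t => sol.ρ x t * Real.exp (psi sol x t))
      (Ft := fun x t => pdt sol.ρ x t * Real.exp (psi sol x t)
        + sol.ρ x t * (Real.exp (psi sol x t) * gg sol x t))
      (Fx := fun x t => pdx sol.ρ x t * Real.exp (psi sol x t)
        + sol.ρ x t * (Real.exp (psi sol x t) * (sol.ρ x t * sol.u x t)))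
      (u := sol.u) ?_ ?_ ?_ ?_ (fun t ht => (sol.bc_u t ht).1) (fun t ht => (sol.bc_u t ht).2)
      ?_ hx ht
    · exact (hρ.cont.mul (Real.continuous_exp.comp (psi_cont sol))).continuousOn
    · intro x hx t ht
      exact (hρ.hasT x t).fun_mul (psi_hasT sol x t).exp
    · intro x hx t ht
      exact (hρ.hasX x t).fun_mul (psi_hasX sol hx ht).exp
    · intro x hx t ht
      have p1 := sol.ρ_pos x hx t ht
      have p3 := sol.θ_pos x hx t ht
      have e := pt_mass sol hx ht
      have e2 : pdt sol.ρ x t * Real.exp (psi sol x t)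
        + sol.ρ x t * (Real.exp (psi sol x t) * gg sol x t)
        + sol.u x t * (pdx sol.ρ x t * Real.exp (psi sol x t)
        + sol.ρ x t * (Real.exp (psi sol x t) * (sol.ρ x t * sol.u x t)))
        = - (Real.exp (psi sol x t) * sol.ρ x t * (sol.ρ x t * sol.θ x t
          + (sol.b 0 x t * sol.b 0 x t + sol.b 1 x t * sol.b 1 x t) / 2)) := by
        unfold gg nn
        linear_combination Real.exp (psi sol x t) * e
      simp only [e2]
      have := mul_self_nonneg (sol.b 0 x t)
      have := mul_self_nonneg (sol.b 1 x t)
      have : 0 ≤ Real.exp (psi sol x t) * sol.ρ x t * (sol.ρ x t * sol.θ x t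
          + (sol.b 0 x t * sol.b 0 x t + sol.b 1 x t * sol.b 1 x t) / 2) := by positivity
      linarith
    · intro x hx
      have := (abs_le.1 (psi_zero_le sol h hx)).2
      apply mul_le_mul ((le_abs_self _).trans (le_one_add_sq (init_pt sol h hx).1))
        (Real.exp_le_exp.2 this) (Real.exp_pos _).le (by positivity)
  have low := psi_lower hT hκ sol h hx ht
  have e : sol.ρ x t = sol.ρ x t * Real.exp (psi sol x t) * Real.exp (- psi sol x t) := by
    rw [mul_assoc, ← Real.exp_add]; simp
  rw [e]
  unfold RR
  exact mul_le_mul key (Real.exp_le_exp.2 (by linarith)) (Real.exp_pos _).le (by positivity)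

end fields

lemma rpow_le_one_add {s a b : ℝ} (hs : 0 < s) (ha : 0 ≤ a) (hab : a ≤ b) :
    s ^ a ≤ 1 + s ^ b := by
  rcases le_total s 1 with h | h
  · have := Real.rpow_le_one hs.le h ha
    have := Real.rpow_nonneg hs.le b
    linarith
  · have := Real.rpow_le_rpow_of_exponent_le h hab
    linarith

lemma young_eps {α ε : ℝ} (hα : 0 < α) (hα1 : α < 1) (hε : 0 < ε) :
    ∃ C : ℝ, 0 < C ∧ ∀ s : ℝ, 0 < s → s ^ (1 - α) ≤ ε * s + C := by
  set s₀ := ε ^ (-(1 / α)) with hs₀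
  have hs0 : 0 < s₀ := Real.rpow_pos_of_pos hε _
  refine ⟨s₀ ^ (1 - α), Real.rpow_pos_of_pos hs0 _, fun s hs => ?_⟩
  rcases le_total s s₀ with h | h
  · have := Real.rpow_le_rpow hs.le h (by linarith : 0 ≤ 1 - α)
    have := mul_pos hε hs
    linarith
  · have h1 : s ^ (-α) ≤ s₀ ^ (-α) := Real.rpow_le_rpow_of_nonpos hs0 h (by linarith)
    have h2 : s₀ ^ (-α) = ε := by
      rw [hs₀, ← Real.rpow_mul hε.le]
      have : -(1 / α) * -α = 1 := by field_simp
      rw [this, Real.rpow_one]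
    have h3 : s ^ (1 - α) = s * s ^ (-α) := by
      rw [sub_eq_add_neg, Real.rpow_add hs, Real.rpow_one]
    have h4 := Real.rpow_pos_of_pos hs0 (1 - α)
    rw [h3]
    rw [h2] at h1
    nlinarith

section fields

variable {T : ℝ} {κ : ℝ → ℝ}

/-- The integrand. -/
def JJ (sol : MHDSol T κ) (q α : ℝ) : ℝ → ℝ → ℝ := fun x t =>
  diss sol x t / (sol.θ x t) ^ α
    + (1 + (sol.θ x t) ^ q) * (pdx sol.θ x t) ^ 2 / (sol.θ x t) ^ (1 + α)

def GG (sol : MHDSol T κ) (α : ℝ) : ℝ → ℝ → ℝ := fun x t =>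
  diss sol x t * (sol.θ x t) ^ (-α)
    + α * κ (sol.θ x t) * (pdx sol.θ x t) ^ 2 * (sol.θ x t) ^ (-α - 1)
    - sol.ρ x t * (sol.θ x t) ^ (1 - α) * pdx sol.u x t

lemma diss_cont (sol : MHDSol T κ) : Continuous (fun p : ℝ × ℝ => diss sol p.1 p.2) := by
  have hu : Sm sol.u := sol.smooth_u
  have hw : ∀ i, Sm (sol.w i) := sol.smooth_w
  have hb : ∀ i, Sm (sol.b i) := sol.smooth_b
  exact ((hu.dx.cont.pow 2).add (((hw 0).dx.cont.pow 2).add ((hw 1).dx.cont.pow 2))).add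
    (((hb 0).dx.cont.pow 2).add ((hb 1).dx.cont.pow 2))

lemma theta_rpow_cont (sol : MHDSol T κ) (a : ℝ) :
    ContinuousOn (fun p : ℝ × ℝ => (sol.θ p.1 p.2) ^ a) (Icc (0:ℝ) 1 ×ˢ Icc (0:ℝ) T) := by
  have hθ : Sm sol.θ := sol.smooth_θ
  exact hθ.cont.continuousOn.rpow_const (fun p hp => Or.inl (sol.θ_pos p.1 hp.1 p.2 hp.2).ne')

lemma JJ_cont (sol : MHDSol T κ) (q α : ℝ) :
    ContinuousOn (fun p : ℝ × ℝ => JJ sol q α p.1 p.2) (Icc (0:ℝ) 1 ×ˢ Icc (0:ℝ) T) := by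
  have hθ : Sm sol.θ := sol.smooth_θ
  refine ((diss_cont sol).continuousOn.div (theta_rpow_cont sol α) ?_).add
    (((continuousOn_const.add (theta_rpow_cont sol q)).mul (hθ.dx.cont.pow 2).continuousOn).div
      (theta_rpow_cont sol (1 + α)) ?_)
  · exact fun p hp => (Real.rpow_pos_of_pos (sol.θ_pos p.1 hp.1 p.2 hp.2) _).ne'
  · exact fun p hp => (Real.rpow_pos_of_pos (sol.θ_pos p.1 hp.1 p.2 hp.2) _).ne'

lemma GG_cont {q C₀ : ℝ} (hκ : KappaHyp q C₀ κ) (sol : MHDSol T κ) (α : ℝ) :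
    ContinuousOn (fun p : ℝ × ℝ => GG sol α p.1 p.2) (Icc (0:ℝ) 1 ×ˢ Icc (0:ℝ) T) := by
  have hρ : Sm sol.ρ := sol.smooth_ρ
  have hu : Sm sol.u := sol.smooth_u
  have hθ : Sm sol.θ := sol.smooth_θ
  have ck : ContinuousOn (fun p : ℝ × ℝ => κ (sol.θ p.1 p.2)) (Icc (0:ℝ) 1 ×ˢ Icc (0:ℝ) T) :=
    hκ.1.continuousOn.comp (f := fun p : ℝ × ℝ => sol.θ p.1 p.2) hθ.cont.continuousOn
      (fun p hp => (sol.θ_pos p.1 hp.1 p.2 hp.2).le)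
  exact (((diss_cont sol).continuousOn.mul (theta_rpow_cont sol (-α))).add
    (((continuousOn_const.mul ck).mul (hθ.dx.cont.pow 2).continuousOn).mul
      (theta_rpow_cont sol (-α - 1)))).sub
    ((hρ.cont.continuousOn.mul (theta_rpow_cont sol (1 - α))).mul hu.dx.cont.continuousOn)

lemma diss_nonneg (sol : MHDSol T κ) (x t : ℝ) : (pdx sol.u x t) ^ 2 ≤ diss sol x t := by
  unfold diss
  have := sq_nonneg (pdx (sol.w 0) x t)
  have := sq_nonneg (pdx (sol.w 1) x t)
  have := sq_nonneg (pdx (sol.b 0) x t)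
  have := sq_nonneg (pdx (sol.b 1) x t)
  linarith

lemma rhotheta_le {q C₀ A B M : ℝ} (hT : 0 < T) (hκ : KappaHyp q C₀ κ) (sol : MHDSol T κ)
    (h : InitBounds sol A B M) {t : ℝ} (ht : t ∈ Icc (0:ℝ) T) :
    ∫ x in (0:ℝ)..1, sol.ρ x t * sol.θ x t ≤ 4 * (1 + 2 * A ^ 2) ^ 2 := by
  have hρ : Sm sol.ρ := sol.smooth_ρ
  have hθ : Sm sol.θ := sol.smooth_θ
  refine le_trans ?_ (energy_le hT hκ sol h ht)
  apply intervalIntegral.integral_mono_on zero_le_one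
  · exact ((hρ.cont2 continuous_id continuous_const).mul
      (hθ.cont2 continuous_id continuous_const)).intervalIntegrable _ _
  · exact ((energy_sm sol).cont2 continuous_id continuous_const).intervalIntegrable _ _
  intro x hx
  have p1 := sol.ρ_pos x hx t ht
  unfold energy
  have a0 := mul_nonneg p1.le (mul_self_nonneg (sol.u x t))
  have a1 := mul_nonneg p1.le (mul_self_nonneg (sol.w 0 x t))
  have a2 := mul_nonneg p1.le (mul_self_nonneg (sol.w 1 x t))
  nlinarith [mul_self_nonneg (sol.b 0 x t), mul_self_nonneg (sol.b 1 x t)]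

lemma theta_sup {q C₀ α A B M : ℝ} (hT : 0 < T) (hκ : KappaHyp q C₀ κ) (hα : 0 < α)
    (hαq : α < q) (hM : 0 < M) (sol : MHDSol T κ)
    (h : InitBounds sol A B M) {x t : ℝ} (hx : x ∈ Icc (0:ℝ) 1) (ht : t ∈ Icc (0:ℝ) T) :
    sol.θ x t ≤ 2 * (4 * (1 + 2 * A ^ 2) ^ 2 / M) + ∫ y in (0:ℝ)..1, JJ sol q α y t := by
  have hρ : Sm sol.ρ := sol.smooth_ρ
  have hθ : Sm sol.θ := sol.smooth_θ
  have cρ : Continuous (fun x => sol.ρ x t) := hρ.cont2 continuous_id continuous_const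
  have cθ : Continuous (fun x => sol.θ x t) := hθ.cont2 continuous_id continuous_const
  have cθx : Continuous (fun x => pdx sol.θ x t) := hθ.dx.cont2 continuous_id continuous_const
  have cJ := sliceX ht (JJ_cont sol q α)
  obtain ⟨z, hz, hmax⟩ := isCompact_Icc.exists_isMaxOn (nonempty_Icc.2 zero_le_one)
    (cθ.continuousOn (s := Icc (0:ℝ) 1))
  have hm : ∀ y ∈ Icc (0:ℝ) 1, sol.θ y t ≤ sol.θ z t := fun y hy => hmax hy
  obtain ⟨y, hy, hyle⟩ := exists_le_avg cρ.continuousOn cθ.continuousOn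
    (fun x hx => (sol.ρ_pos x hx t ht).le)
  have h1 : sol.θ y t ≤ 4 * (1 + 2 * A ^ 2) ^ 2 / M := by
    rw [le_div_iff₀ hM]
    have e1 := rhotheta_le hT hκ sol h ht
    have e2 : M ≤ ∫ x in (0:ℝ)..1, sol.ρ x t := by
      rw [mass_cons sol ht]; exact h.2.2.2.2.2.2
    have e3 := mul_le_mul_of_nonneg_left e2 (sol.θ_pos y hy t ht).le
    linarith
  have os := osc (f := fun x => sol.θ x t) (f' := fun x => pdx sol.θ x t)
    (g := fun x => (1 / 2) * JJ sol q α x t + (1 / 2) * sol.θ z t)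
    (fun x _ => hθ.hasX x t) cθx.continuousOn
    ((continuousOn_const.mul cJ).add continuousOn_const)
    (fun x hx => by
      have p := sol.θ_pos x hx t ht
      have l := hm x hx
      set s := sol.θ x t with hs
      have pa := Real.rpow_pos_of_pos p α
      have e1 : s ^ (1 + α) = s * s ^ α := by rw [Real.rpow_add p, Real.rpow_one]
      have e2 := rpow_le_one_add p hα.le hαq.le
      have e3 : (pdx sol.θ x t) ^ 2 / s ≤ JJ sol q α x t := by
        unfold JJ
        rw [← hs, e1]
        have d : 0 ≤ diss sol x t / s ^ α :=
          div_nonneg ((sq_nonneg _).trans (diss_nonneg sol x t)) pa.le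
        have : (pdx sol.θ x t) ^ 2 / s ≤ (1 + s ^ q) * (pdx sol.θ x t) ^ 2 / (s * s ^ α) := by
          rw [div_le_div_iff₀ p (by positivity)]
          have := mul_le_mul_of_nonneg_right e2
            (mul_nonneg (sq_nonneg (pdx sol.θ x t)) p.le)
          linarith
        linarith
      have e4 : |pdx sol.θ x t| ≤ 1 / 2 * ((pdx sol.θ x t) ^ 2 / s) + 1 / 2 * s := by
        have : (pdx sol.θ x t) ^ 2 / s * s = |pdx sol.θ x t| ^ 2 := by
          rw [sq_abs]; field_simp
        set v := (pdx sol.θ x t) ^ 2 / s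
        have hh : 0 ≤ (v - 2 * |pdx sol.θ x t| + s) * s := by
          nlinarith [sq_nonneg (|pdx sol.θ x t| - s)]
        have := nonneg_of_mul_nonneg_left hh p
        linarith
      linarith) hz hy
  have cJ2 : IntervalIntegrable (fun x => (1 / 2) * JJ sol q α x t) volume 0 1 :=
    ii01 zero_le_one (continuousOn_const.mul cJ)
  rw [intervalIntegral.integral_add cJ2
    (continuous_const.intervalIntegrable _ _), intervalIntegral.integral_const_mul] at os
  simp only [intervalIntegral.integral_const, sub_zero, one_smul] at os
  have := hm x hx
  linarith

lemma alpha_balance {q C₀ α : ℝ} (hT : 0 < T) (hκ : KappaHyp q C₀ κ) (hα1 : α < 1)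
    (sol : MHDSol T κ) :
    (∫ x in (0:ℝ)..1, (1 - α)⁻¹ * (sol.ρ x T * (sol.θ x T) ^ (1 - α)))
      = (∫ x in (0:ℝ)..1, (1 - α)⁻¹ * (sol.ρ x 0 * (sol.θ x 0) ^ (1 - α)))
      + ∫ t in (0:ℝ)..T, ∫ x in (0:ℝ)..1, GG sol α x t := by
  have hρ : Sm sol.ρ := sol.smooth_ρ
  have hu : Sm sol.u := sol.smooth_u
  have hθ : Sm sol.θ := sol.smooth_θ
  have hc : (1 - α)⁻¹ * (1 - α) = 1 := inv_mul_cancel₀ (by linarith)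
  set c := (1 - α)⁻¹ with hcdef
  refine balance hT.le (fun x t => c * (sol.ρ x t * (sol.θ x t) ^ (1 - α)))
    (fun x t => c * (pdt sol.ρ x t * (sol.θ x t) ^ (1 - α)
      + sol.ρ x t * (pdt sol.θ x t * (1 - α) * (sol.θ x t) ^ (1 - α - 1))))
    (fun x t => c * (sol.ρ x t * sol.u x t * (sol.θ x t) ^ (1 - α))
      - flux sol x t * (sol.θ x t) ^ (-α)) (GG sol α) ?_ ?_ ?_ ?_ (GG_cont hκ sol α) ?_ ?_
  · intro x hx t ht
    have p := sol.θ_pos x hx t ht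
    exact ((hρ.hasT x t).fun_mul ((hθ.hasT x t).rpow_const (Or.inl p.ne'))).const_mul c
  · intro x hx t ht
    have p := sol.θ_pos x hx t ht
    refine (((((hρ.hasX x t).fun_mul (hu.hasX x t)).fun_mul
      ((hθ.hasX x t).rpow_const (Or.inl p.ne'))).const_mul c).fun_sub
      ((flux_hasX hκ sol hx ht).fun_mul
        ((hθ.hasX x t).rpow_const (p := -α) (Or.inl p.ne')))).congr_deriv ?_
    have h1 := pt_mass sol hx ht
    have h7 := pt_θ sol hx ht
    have e1 : (sol.θ x t) ^ (1 - α) = sol.θ x t * (sol.θ x t) ^ (-α) := by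
      rw [sub_eq_add_neg, Real.rpow_add p, Real.rpow_one]
    have e2 : (1 - α - 1) = -α := by ring
    have e3 : flux sol x t = κ (sol.θ x t) * pdx sol.θ x t := rfl
    unfold GG
    rw [e2, e1, e3]
    set P := (sol.θ x t) ^ (-α)
    set Q := (sol.θ x t) ^ (-α - 1)
    linear_combination P * h7 + (c - 1) * sol.θ x t * P * h1
      + hc * (sol.ρ x t * P * (pdt sol.θ x t + sol.u x t * pdx sol.θ x t))
  · exact continuousOn_const.mul (hρ.cont.continuousOn.mul (theta_rpow_cont sol _))
  · exact continuousOn_const.mul ((hρ.dt.cont.continuousOn.mul (theta_rpow_cont sol _)).add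
      (hρ.cont.continuousOn.mul ((hθ.dt.cont.continuousOn.mul continuousOn_const).mul
        (theta_rpow_cont sol _))))
  · intro t ht
    simp [flux, (sol.bc_u t ht).1, (sol.bc_θ t ht).1]
  · intro t ht
    simp [flux, (sol.bc_u t ht).2, (sol.bc_θ t ht).2]

/-- Pointwise lower bound for the production term. -/
lemma GG_lower {q C₀ α c₁ R : ℝ} (hC₀ : 1 ≤ C₀) (hκ : KappaHyp q C₀ κ) (hα : 0 < α)
    (hc1 : c₁ ≤ 1 / 2) (hc2 : c₁ ≤ α * C₀⁻¹)
    (sol : MHDSol T κ) {x t : ℝ} (hx : x ∈ Icc (0:ℝ) 1) (ht : t ∈ Icc (0:ℝ) T)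
    (hR : sol.ρ x t ≤ R) :
    c₁ * JJ sol q α x t
      ≤ GG sol α x t + R / 2 * (sol.ρ x t * sol.θ x t * (sol.θ x t) ^ (1 - α)) := by
  have p := sol.θ_pos x hx t ht
  have pr := sol.ρ_pos x hx t ht
  have hd := diss_nonneg sol x t
  have hk := hκ.2.1 _ p.le
  unfold JJ GG
  set s := sol.θ x t
  set r := sol.ρ x t
  set ux := pdx sol.u x t
  set D := diss sol x t
  set y := (pdx sol.θ x t) ^ 2 with hy
  have y0 : 0 ≤ y := sq_nonneg _
  have e1 : s ^ (1 - α) = s * s ^ (-α) := by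
    rw [sub_eq_add_neg, Real.rpow_add p, Real.rpow_one]
  have e2 : D / s ^ α = D * s ^ (-α) := by rw [Real.rpow_neg p.le, div_eq_mul_inv]
  have e3 : (1 + s ^ q) * y / s ^ (1 + α) = (1 + s ^ q) * y * s ^ (-α - 1) := by
    rw [show -α - 1 = -(1 + α) by ring, Real.rpow_neg p.le (1 + α), div_eq_mul_inv]
  rw [e1, e2, e3]
  have P0 := Real.rpow_pos_of_pos p (-α)
  have Q0 := Real.rpow_pos_of_pos p (-α - 1)
  have q0 := Real.rpow_pos_of_pos p q
  set P := s ^ (-α)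
  set Q := s ^ (-α - 1)
  have D0 : 0 ≤ D := (sq_nonneg _).trans hd
  have a1 : c₁ * (D * P) ≤ 1 / 2 * (D * P) :=
    mul_le_mul_of_nonneg_right hc1 (mul_nonneg D0 P0.le)
  have a2 : c₁ * ((1 + s ^ q) * y * Q) ≤ α * κ s * y * Q := by
    have b1 : c₁ * ((1 + s ^ q) * y * Q) ≤ α * C₀⁻¹ * ((1 + s ^ q) * y * Q) :=
      mul_le_mul_of_nonneg_right hc2 (by positivity)
    have b2 := mul_le_mul_of_nonneg_left hk (show 0 ≤ α * (y * Q) by positivity)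
    nlinarith
  have a3 : r * (s * P) * ux ≤ 1 / 2 * (D * P) + R / 2 * (r * s * (s * P)) := by
    have b1 : r * s * ux ≤ 1 / 2 * D + 1 / 2 * (r * s) ^ 2 := by
      nlinarith [sq_nonneg (r * s - ux)]
    have b2 := mul_le_mul_of_nonneg_right b1 P0.le
    have b3 := mul_le_mul_of_nonneg_right hR (show 0 ≤ r * s * s * P by positivity)
    nlinarith
  linarith

end fields

/-- Lemma 2.3, estimate (2.4): for any `0 < α < min{1, q}` there is a
constant `C` depending only on `α, T, q, C₀` and on the initial data (upper bound `A`
for the `H²` norms, upper bound `B` for `∫₀¹ ρ₀(|ln ρ₀| + |ln θ₀|) dx`, positive lower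
bound `M` for `∫₀¹ ρ₀ dx`), but not on the pointwise lower bounds of `ρ₀` and `θ₀`,
such that every smooth solution satisfies
`∬_{Q_T} [(u_x² + |w_x|² + |b_x|²)/θ^α + (1 + θ^q) θ_x²/θ^{1+α}] dx dt ≤ C`. -/
theorem stmt9 (T q C₀ : ℝ) (hT : 0 < T) (hq : 0 < q) (hC₀ : 1 ≤ C₀)
    (κ : ℝ → ℝ) (hκ : KappaHyp q C₀ κ)
    (α : ℝ) (hα : 0 < α) (hα' : α < min 1 q) (A B M : ℝ) (hM : 0 < M) :
    ∃ C : ℝ, 0 < C ∧ ∀ sol : MHDSol T κ, InitBounds sol A B M →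
      (∫ s in (0:ℝ)..T, ∫ y in (0:ℝ)..1,
          ((pdx sol.u y s) ^ 2 + (∑ i, (pdx (sol.w i) y s) ^ 2)
            + (∑ i, (pdx (sol.b i) y s) ^ 2)) / (sol.θ y s) ^ α
          + (1 + (sol.θ y s) ^ q) * (pdx sol.θ y s) ^ 2 / (sol.θ y s) ^ (1 + α)) ≤ C := by
  have hα1 : α < 1 := hα'.trans_le (min_le_left _ _)
  have hαq : α < q := hα'.trans_le (min_le_right _ _)
  have hC0 : 0 < C₀ := by linarith
  obtain ⟨c₁, hc0, hc1, hc2⟩ : ∃ c₁ : ℝ, 0 < c₁ ∧ c₁ ≤ 1 / 2 ∧ c₁ ≤ α * C₀⁻¹ :=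
    ⟨min (1 / 2) (α * C₀⁻¹), by positivity, min_le_left _ _, min_le_right _ _⟩
  obtain ⟨K, hK⟩ : ∃ K, K = 1 + 2 * A ^ 2 := ⟨_, rfl⟩
  have hK0 : 0 < K := by rw [hK]; positivity
  obtain ⟨E, hE⟩ : ∃ E, E = 4 * K ^ 2 := ⟨_, rfl⟩
  have hE0 : 0 < E := by rw [hE]; positivity
  obtain ⟨R, hR⟩ : ∃ R, R = RR T A := ⟨_, rfl⟩
  have hR0 : 0 < R := by rw [hR]; unfold RR; positivity
  obtain ⟨ε, hε⟩ : ∃ ε, ε = c₁ / (R * E) := ⟨_, rfl⟩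
  have hε0 : 0 < ε := by rw [hε]; positivity
  have hεRE : R * E * ε = c₁ := by rw [hε]; field_simp
  obtain ⟨Cε, hCε0, hCε⟩ := young_eps hα hα1 hε0
  obtain ⟨D, hD⟩ : ∃ D, D = R / 2 * (E * (ε * (2 * (E / M)) + Cε)) := ⟨_, rfl⟩
  have hD0 : 0 < D := by rw [hD]; positivity
  have hci : 0 < (1 - α)⁻¹ := inv_pos.2 (by linarith)
  refine ⟨2 / c₁ * ((1 - α)⁻¹ * (K + E) + T * D), by positivity, fun sol h => ?_⟩
  simp only [Fin.sum_univ_two]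
  show (∫ s in (0:ℝ)..T, ∫ y in (0:ℝ)..1, JJ sol q α y s) ≤ _
  have hρ : Sm sol.ρ := sol.smooth_ρ
  have hθ : Sm sol.θ := sol.smooth_θ
  have bal := alpha_balance hT hκ hα1 sol
  have cρ : ∀ t, Continuous (fun x => sol.ρ x t) := fun t => hρ.cont2 continuous_id continuous_const
  have cθ : ∀ t, Continuous (fun x => sol.θ x t) := fun t => hθ.cont2 continuous_id continuous_const
  -- terminal and initial terms
  have f0 : 0 ≤ ∫ x in (0:ℝ)..1, (1 - α)⁻¹ * (sol.ρ x 0 * (sol.θ x 0) ^ (1 - α)) := by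
    apply intervalIntegral.integral_nonneg zero_le_one
    intro x hx
    have p1 := sol.ρ_pos x hx 0 ⟨le_rfl, hT.le⟩
    have p2 := sol.θ_pos x hx 0 ⟨le_rfl, hT.le⟩
    positivity
  have hTT : T ∈ Icc (0:ℝ) T := ⟨hT.le, le_rfl⟩
  have fT : ∫ x in (0:ℝ)..1, (1 - α)⁻¹ * (sol.ρ x T * (sol.θ x T) ^ (1 - α))
      ≤ (1 - α)⁻¹ * (K + E) := by
    rw [intervalIntegral.integral_const_mul]
    apply mul_le_mul_of_nonneg_left _ hci.le
    have m := mass_le sol h hTT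
    have e := rhotheta_le hT hκ sol h hTT
    rw [← hK] at m e
    rw [← hE] at e
    have cpow := sliceX (f := fun x t => sol.θ x t ^ (1 - α)) hTT (theta_rpow_cont sol (1 - α))
    calc ∫ x in (0:ℝ)..1, sol.ρ x T * (sol.θ x T) ^ (1 - α)
        ≤ ∫ x in (0:ℝ)..1, (sol.ρ x T + sol.ρ x T * sol.θ x T) := by
          apply intervalIntegral.integral_mono_on zero_le_one
          · exact ii01 zero_le_one ((cρ T).continuousOn.mul cpow)
          · exact ((cρ T).add ((cρ T).mul (cθ T))).intervalIntegrable _ _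
          intro x hx
          have p1 := sol.ρ_pos x hx T hTT
          have p2 := sol.θ_pos x hx T hTT
          have := rpow_le_one_add (a := 1 - α) (b := 1) p2 (by linarith) (by linarith)
          rw [Real.rpow_one] at this
          nlinarith
      _ = (∫ x in (0:ℝ)..1, sol.ρ x T) + ∫ x in (0:ℝ)..1, sol.ρ x T * sol.θ x T :=
          intervalIntegral.integral_add ((cρ T).intervalIntegrable _ _)
            (((cρ T).mul (cθ T)).intervalIntegrable _ _)
      _ ≤ K + E := by linarith
  -- time slices
  have slice : ∀ t ∈ Icc (0:ℝ) T, c₁ / 2 * (∫ x in (0:ℝ)..1, JJ sol q α x t)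
      ≤ (∫ x in (0:ℝ)..1, GG sol α x t) + D := by
    intro t ht
    have cJ := sliceX ht (JJ_cont sol q α)
    have cG := sliceX ht (GG_cont hκ sol α)
    set J := ∫ x in (0:ℝ)..1, JJ sol q α x t with hJ
    have sup : ∀ x ∈ Icc (0:ℝ) 1, sol.θ x t ≤ 2 * (E / M) + J := by
      intro x hx
      have := theta_sup hT hκ hα hαq hM sol h hx ht
      rw [← hK, ← hE] at this
      exact this
    have e := rhotheta_le hT hκ sol h ht
    rw [← hK, ← hE] at e
    have J0 : 0 ≤ ε * (2 * (E / M) + J) + Cε := by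
      have := sup 0 ⟨le_rfl, zero_le_one⟩
      have := sol.θ_pos 0 ⟨le_rfl, zero_le_one⟩ t ht
      have : 0 < 2 * (E / M) + J := by linarith
      positivity
    have i1 : ∫ x in (0:ℝ)..1, c₁ * JJ sol q α x t ≤ ∫ x in (0:ℝ)..1, (GG sol α x t
        + (R / 2 * (ε * (2 * (E / M) + J) + Cε)) * (sol.ρ x t * sol.θ x t)) := by
      apply intervalIntegral.integral_mono_on zero_le_one
      · exact ii01 zero_le_one (continuousOn_const.mul cJ)
      · exact ii01 zero_le_one (cG.add (continuousOn_const.mul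
          ((cρ t).mul (cθ t)).continuousOn))
      intro x hx
      have p1 := sol.ρ_pos x hx t ht
      have p2 := sol.θ_pos x hx t ht
      have g := GG_lower hC₀ hκ hα hc1 hc2 sol hx ht (R := R)
        (by rw [hR]; exact rho_le hT hκ sol h hx ht)
      have y := hCε _ p2
      have y2 : sol.θ x t ^ (1 - α) ≤ ε * (2 * (E / M) + J) + Cε := by
        have := mul_le_mul_of_nonneg_left (sup x hx) hε0.le
        linarith
      have y3 := mul_le_mul_of_nonneg_left y2
        (show 0 ≤ R / 2 * (sol.ρ x t * sol.θ x t) by positivity)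
      nlinarith
    have cR : IntervalIntegrable (fun x => (R / 2 * (ε * (2 * (E / M) + J) + Cε)) *
        (sol.ρ x t * sol.θ x t)) volume 0 1 :=
      (((cρ t).mul (cθ t)).const_mul _).intervalIntegrable _ _
    rw [intervalIntegral.integral_const_mul, intervalIntegral.integral_add (ii01 zero_le_one cG) cR,
      intervalIntegral.integral_const_mul, ← hJ] at i1
    have i2 := mul_le_mul_of_nonneg_left e
      (show 0 ≤ R / 2 * (ε * (2 * (E / M) + J) + Cε) by positivity)
    have i3 : R / 2 * (ε * (2 * (E / M) + J) + Cε) * E = c₁ / 2 * J + D := by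
      rw [hD]
      linear_combination (J / 2) * hεRE
    linarith
  have tot : ∫ t in (0:ℝ)..T, c₁ / 2 * (∫ x in (0:ℝ)..1, JJ sol q α x t)
      ≤ ∫ t in (0:ℝ)..T, ((∫ x in (0:ℝ)..1, GG sol α x t) + D) := by
    apply intervalIntegral.integral_mono_on hT.le _ _ slice
    · exact (ii_param hT.le (JJ_cont sol q α)).const_mul _
    · exact (ii_param hT.le (GG_cont hκ sol α)).add (continuous_const.intervalIntegrable _ _)
  rw [intervalIntegral.integral_const_mul, intervalIntegral.integral_add
    (ii_param hT.le (GG_cont hκ sol α)) (continuous_const.intervalIntegrable _ _),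
    intervalIntegral.integral_const, smul_eq_mul, sub_zero] at tot
  rw [div_mul_eq_mul_div, le_div_iff₀ hc0]
  linarith
end
end
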